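/- For every δ, δ' ≥ 0 and x, x' ≥ 0, the law of the sum of two independent squared Bessel processes of dimensions δ and δ' started at x and x' respectively equals the law of a squared Bessel process of dimension δ+δ' started at x+x'. Here a squared Bessel process of dimension δ started at x is the unique strong solution of dX_u = δ du + 2√(X_u) dW_u, X_0 = x. -/

import Mathlib

open MeasureTheory ProbabilityTheory Filter

noncomputable section

/-- The path space `C(ℝ⁺, ℝ)` modelled as functions `ℝ → ℝ`. -/
abbrev RPath : Type := ℝ → ℝ

/-- The class `D` of nonnegative, measurable, locally bounded, piecewise
continuous functions. -/
def MemD (f : ℝ → ℝ) : Prop :=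
  Measurable f ∧ (∀ t, 0 ≤ f t) ∧
    (∀ T : ℝ, ∃ C : ℝ, ∀ t ∈ Set.Icc (0 : ℝ) T, f t ≤ C) ∧
    ∃ S : Set ℝ, S.Countable ∧ ∀ t ∉ S, ContinuousAt f t

/-- `W` is a standard Brownian motion with respect to the filtration `ℱ`:
it starts at `0`, has continuous paths, is adapted, has Gaussian increments
`W t - W s ∼ N(0, t - s)` that are independent of `ℱ s`. -/
structure IsBrownianMotion {Ω : Type*} [m : MeasurableSpace Ω] (P : Measure Ω)
    (ℱ : Filtration ℝ m) (W : ℝ → Ω → ℝ) : Prop where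
  start : ∀ ω, W 0 ω = 0
  cont : ∀ ω, Continuous fun t => W t ω
  adapted : Adapted ℱ W
  gaussian_increments : ∀ s t : ℝ, 0 ≤ s → s ≤ t →
    P.map (fun ω => W t ω - W s ω) = gaussianReal 0 (Real.toNNReal (t - s))
  indep_increments : ∀ s t : ℝ, 0 ≤ s → s ≤ t →
    Indep (MeasurableSpace.comap (fun ω => W t ω - W s ω) (borel ℝ)) (ℱ s) P

/-- `X` is a (strong) solution of the SDE `dX_t = b(t, X_t) dt + σ(X_t) dW_t`,
`X_0 = x`, formulated through the martingale problem relative to `W`: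
`M_t := X_t - x - ∫_0^t b(s, X_s) ds` is a martingale, its quadratic variation
is `∫_0^t σ(X_s)² ds`, and its covariation with `W` is `∫_0^t σ(X_s) ds`
(the latter characterizes `M_t = ∫_0^t σ(X_s) dW_s`). -/
structure IsSDESolution {Ω : Type*} [m : MeasurableSpace Ω] (P : Measure Ω)
    (ℱ : Filtration ℝ m) (W : ℝ → Ω → ℝ)
    (b : ℝ → ℝ → ℝ) (σ : ℝ → ℝ) (x : ℝ) (X : ℝ → Ω → ℝ) : Prop where
  init : ∀ ω, X 0 ω = x
  cont : ∀ ω, Continuous fun t => X t ω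
  adapted : Adapted ℱ X
  drift_mart : Martingale
    (fun t ω => X t ω - x - ∫ s in Set.Ioc (0 : ℝ) t, b s (X s ω)) ℱ P
  quad_var : Martingale
    (fun t ω => (X t ω - x - ∫ s in Set.Ioc (0 : ℝ) t, b s (X s ω)) ^ 2
      - ∫ s in Set.Ioc (0 : ℝ) t, (σ (X s ω)) ^ 2) ℱ P
  driven_by : Martingale
    (fun t ω => (X t ω - x - ∫ s in Set.Ioc (0 : ℝ) t, b s (X s ω)) * W t ω
      - ∫ s in Set.Ioc (0 : ℝ) t, σ (X s ω)) ℱ P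

/-- The drift `(t, y) ↦ 2 β_t y + δ_t` of the generalized squared Bessel process. -/
def gbesqDrift (β δ : ℝ → ℝ) : ℝ → ℝ → ℝ := fun t y => 2 * β t * y + δ t

/-- The diffusion coefficient `y ↦ 2 √y` of the squared Bessel process. -/
def besqSigma : ℝ → ℝ := fun y => 2 * Real.sqrt y

/-- `X` is a generalized squared Bessel process `GBESQ^{β,δ}_x` driven by `W`. -/
def IsGBESQ {Ω : Type*} [m : MeasurableSpace Ω] (P : Measure Ω)
    (ℱ : Filtration ℝ m) (W : ℝ → Ω → ℝ) (β δ : ℝ → ℝ) (x : ℝ)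
    (X : ℝ → Ω → ℝ) : Prop :=
  IsSDESolution P ℱ W (gbesqDrift β δ) besqSigma x X

/-- The law on path space of a process `X`. -/
def pathLaw {Ω : Type*} [m : MeasurableSpace Ω] (P : Measure Ω)
    (X : ℝ → Ω → ℝ) : Measure RPath :=
  P.map fun ω t => X t ω

/-- A realization of the generalized squared Bessel process `GBESQ^{β,δ}_x`
whose law on path space is `μ`. -/
structure GBESQRealization (β δ : ℝ → ℝ) (x : ℝ) (μ : Measure RPath) where
  (Ω : Type)
  [m : MeasurableSpace Ω]
  (P : Measure Ω)
  (ℱ : Filtration ℝ m)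
  (W : ℝ → Ω → ℝ)
  (X : ℝ → Ω → ℝ)
  (prob : IsProbabilityMeasure P)
  (bm : IsBrownianMotion P ℱ W)
  (sol : IsGBESQ P ℱ W β δ x X)
  (law : μ = pathLaw P X)

/-- `μ` is the law `{}^β Q^δ_x` of the generalized squared Bessel process with
drift function `β`, dimension function `δ` and initial value `x`. -/
def IsGBESQLaw (β δ : ℝ → ℝ) (x : ℝ) (μ : Measure RPath) : Prop :=
  Nonempty (GBESQRealization β δ x μ)

/-- Convolution of two laws on path space: the law of the pathwise sum of
independent copies. -/
def mconv (μ ν : Measure RPath) : Measure RPath :=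
  (μ.prod ν).map fun p => p.1 + p.2

set_option linter.unusedSectionVars false

/-- The compensated process. -/
def cM {Ω : Type*} (δ x : ℝ) (X : ℝ → Ω → ℝ) (t : ℝ) (ω : Ω) : ℝ := X t ω - x - δ * max t 0

/-- The bracket. -/
def cV {Ω : Type*} (X : ℝ → Ω → ℝ) (t : ℝ) (ω : Ω) : ℝ :=
  ∫ s in Set.Ioc (0 : ℝ) t, 4 * max (X s ω) 0

/-- Simplified martingale problem. -/
structure Sol {Ω : Type*} [m : MeasurableSpace Ω] (P : Measure Ω)
    (ℱ : Filtration ℝ m) (δ x : ℝ) (X : ℝ → Ω → ℝ) : Prop where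
  init : ∀ ω, X 0 ω = x
  cont : ∀ ω, Continuous fun t => X t ω
  meas : ∀ t, Measurable[ℱ t] (X t)
  martM : Martingale (cM δ x X) ℱ P
  martN : Martingale (fun t ω => (cM δ x X t ω) ^ 2 - cV X t ω) ℱ P

theorem sol_of_sde {Ω : Type*} [m : MeasurableSpace Ω] {P : Measure Ω}
    {ℱ : Filtration ℝ m} {W : ℝ → Ω → ℝ} {δ x : ℝ} {X : ℝ → Ω → ℝ}
    (h : IsGBESQ P ℱ W (fun _ => 0) (fun _ => δ) x X) : Sol P ℱ δ x X := by
  have e1 : ∀ (t : ℝ) (ω : Ω), X t ω - x - ∫ s in Set.Ioc (0 : ℝ) t,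
      gbesqDrift (fun _ => 0) (fun _ => δ) s (X s ω) = cM δ x X t ω := by
    intro t ω
    simp [gbesqDrift, cM, mul_comm]
  have e2 : ∀ (t : ℝ) (ω : Ω), (∫ s in Set.Ioc (0 : ℝ) t, (besqSigma (X s ω)) ^ 2)
      = cV X t ω := by
    intro t ω
    unfold cV besqSigma
    congr 1
    ext s
    rw [mul_pow]
    rcases le_total 0 (X s ω) with h0 | h0
    · rw [Real.sq_sqrt h0, max_eq_left h0]; norm_num
    · rw [Real.sqrt_eq_zero_of_nonpos h0, max_eq_right h0]; norm_num
  refine ⟨h.init, h.cont, h.adapted, ?_, ?_⟩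
  · have := h.drift_mart
    simp only [e1] at this
    exact this
  · have := h.quad_var
    simp only [e1, e2] at this
    exact this

section
variable {Ω : Type*} [m : MeasurableSpace Ω] {P : Measure Ω} [IsProbabilityMeasure P]
    {ℱ : Filtration ℝ m}

theorem mart_mul {F : Type*} [NormedAddCommGroup F] [NormedSpace ℝ F] [CompleteSpace F]
    {N : ℝ → Ω → ℝ} (hN : Martingale N ℱ P) {a b : ℝ} (hab : a ≤ b) {Z : Ω → F}
    (hZ : StronglyMeasurable[ℱ a] Z)
    (hintg : Integrable (fun ω => (N b ω - N a ω) • Z ω) P) :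
    ∫ ω, (N b ω - N a ω) • Z ω ∂P = 0 := by
  have hD : Integrable (fun ω => N b ω - N a ω) P := (hN.integrable b).sub (hN.integrable a)
  have h1 := condExp_bilin_of_stronglyMeasurable_right (m := ℱ a) (μ := P)
    (ContinuousLinearMap.lsmul ℝ ℝ : ℝ →L[ℝ] F →L[ℝ] F) (f := fun ω => N b ω - N a ω) (g := Z)
    hZ hintg hD
  have h2 : P[fun ω => N b ω - N a ω | ℱ a] =ᵐ[P] 0 := by
    have h3 := condExp_sub (hN.integrable b) (hN.integrable a) (ℱ a)
    have h4 := hN.condExp_ae_eq hab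
    have h5 := hN.condExp_ae_eq (le_refl a)
    filter_upwards [h3, h4, h5] with ω h3 h4 h5
    have : (fun ω => N b ω - N a ω) = N b - N a := rfl
    rw [this, h3]
    simp [h4, h5]
  rw [← integral_condExp (ℱ.le a)]
  have h6 : P[fun ω => (N b ω - N a ω) • Z ω | ℱ a] =ᵐ[P] 0 := by
    simp only [ContinuousLinearMap.lsmul_apply] at h1
    filter_upwards [h1, h2] with ω h1 h2
    rw [h1, h2]
    simp
  rw [integral_congr_ae h6]
  simp

namespace Sol
variable {δ x : ℝ} {X : ℝ → Ω → ℝ}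

theorem meas' (S : Sol P ℱ δ x X) (t : ℝ) : Measurable (X t) := (S.meas t).mono (ℱ.le t) le_rfl

theorem meas_cM (S : Sol P ℱ δ x X) (t : ℝ) : Measurable[ℱ t] (cM δ x X t) :=
  ((S.meas t).sub_const x).sub_const _

theorem meas_cM' (S : Sol P ℱ δ x X) (t : ℝ) : Measurable (cM δ x X t) := (S.meas_cM t).mono (ℱ.le t) le_rfl

theorem measU (S : Sol P ℱ δ x X) : Measurable (fun p : ℝ × Ω => X p.1 p.2) :=
  measurable_uncurry_of_continuous_of_measurable S.cont S.meas'

theorem intM (S : Sol P ℱ δ x X) (t : ℝ) : Integrable (cM δ x X t) P := S.martM.integrable t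

theorem intX (S : Sol P ℱ δ x X) (t : ℝ) : Integrable (X t) P := by
  have := ((S.intM t).add (integrable_const x)).add (integrable_const (δ * max t 0))
  refine this.congr (Eventually.of_forall fun ω => ?_)
  simp [cM]; ring

theorem neg_time (S : Sol P ℱ δ x X) {t : ℝ} (ht : t ≤ 0) : X t =ᵐ[P] fun _ => x := by
  have h := S.martM.condExp_ae_eq ht
  have h0 : cM δ x X 0 = fun _ => 0 := by
    ext ω; simp [cM, S.init]
  rw [h0, condExp_const (ℱ.le t)] at h
  filter_upwards [h] with ω h
  simp only [cM, max_eq_right ht] at h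
  linarith

/-- Fubini bound. -/
theorem fub {Z : ℝ → Ω → ℝ} (hZ : Measurable (fun p : ℝ × Ω => Z p.1 p.2))
    (hZ0 : ∀ r ω, 0 ≤ Z r ω) {a b C : ℝ} (hab : a ≤ b)
    (hC : ∀ r ∈ Set.Ioc a b, Integrable (Z r) P ∧ ∫ ω, Z r ω ∂P ≤ C) :
    Integrable (fun ω => ∫ r in Set.Ioc a b, Z r ω) P ∧
      ∫ ω, (∫ r in Set.Ioc a b, Z r ω) ∂P ≤ (b - a) * C := by
  have hI : Integrable (Function.uncurry Z) ((volume.restrict (Set.Ioc a b)).prod P) := by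
    have hZ' : Measurable (Function.uncurry Z) := hZ
    rw [integrable_prod_iff hZ'.aestronglyMeasurable]
    refine ⟨?_, ?_⟩
    · filter_upwards [ae_restrict_mem measurableSet_Ioc] with r hr using (hC r hr).1
    · refine Measure.integrableOn_of_bounded (M := C) (by simp) ?_ ?_
      · exact (hZ.norm.stronglyMeasurable.integral_prod_right).aestronglyMeasurable
      · filter_upwards [ae_restrict_mem measurableSet_Ioc] with r hr
        have e : ∫ y, ‖Function.uncurry Z (r, y)‖ ∂P = ∫ y, Z r y ∂P := by
          congr 1; ext y; simp [Function.uncurry, abs_of_nonneg (hZ0 r y)]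
        rw [e, Real.norm_of_nonneg (integral_nonneg (hZ0 r))]
        exact (hC r hr).2
  refine ⟨hI.integral_prod_right, ?_⟩
  rw [← integral_integral_swap hI]
  calc ∫ r in Set.Ioc a b, ∫ ω, Z r ω ∂P ≤ ∫ r in Set.Ioc a b, C := by
        refine setIntegral_mono_on hI.integral_prod_left (by simp) measurableSet_Ioc ?_
        intro r hr
        exact (hC r hr).2
    _ = (b - a) * C := by simp [hab]

theorem absM_le (S : Sol P ℱ δ x X) {s t : ℝ} (hst : s ≤ t) :
    ∫ ω, |cM δ x X s ω| ∂P ≤ ∫ ω, |cM δ x X t ω| ∂P := by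
  have h := S.martM.condExp_ae_eq hst
  have := integral_abs_condExp_le (m := ℱ s) (μ := P) (cM δ x X t)
  refine le_trans (le_of_eq ?_) this
  refine integral_congr_ae ?_
  filter_upwards [h] with ω h
  rw [h]

theorem bddX (S : Sol P ℱ δ x X) (T : ℝ) : ∃ C, ∀ t ≤ T, ∫ ω, |X t ω| ∂P ≤ C := by
  refine ⟨∫ ω, |cM δ x X T ω| ∂P + |x| + |δ| * |T|, fun t ht => ?_⟩
  have h1 : ∫ ω, |X t ω| ∂P ≤ ∫ ω, (|cM δ x X t ω| + (|x| + |δ| * |T|)) ∂P := by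
    refine integral_mono (S.intX t).abs ((S.intM t).abs.add (integrable_const _)) fun ω => ?_
    have e : X t ω = cM δ x X t ω + (x + δ * max t 0) := by simp [cM]
    have h2 : |δ * max t 0| ≤ |δ| * |T| := by
      rw [abs_mul]
      refine mul_le_mul_of_nonneg_left ?_ (abs_nonneg δ)
      rw [abs_of_nonneg (le_max_right _ _)]
      exact max_le (ht.trans (le_abs_self T)) (abs_nonneg T)
    have h3 := abs_add_le (cM δ x X t ω) (x + δ * max t 0)
    have h4 := abs_add_le x (δ * max t 0)
    simp only
    rw [e]
    linarith
  rw [integral_add (S.intM t).abs (integrable_const _)] at h1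
  have := S.absM_le ht
  simp at h1
  linarith

theorem intV (S : Sol P ℱ δ x X) (t : ℝ) : Integrable (cV X t) P := by
  rcases le_total t 0 with ht | ht
  · have : cV X t = fun _ => 0 := by ext ω; simp [cV, ht]
    rw [this]; exact integrable_const _
  obtain ⟨C, hC⟩ := S.bddX t
  refine (fub (Z := fun s ω => 4 * max (X s ω) 0) (C := 4 * C) ?_ ?_ ht ?_).1
  · exact (S.measU.max measurable_const).const_mul _
  · intro r ω; positivity
  · intro r hr
    have hi : Integrable (fun ω => 4 * max (X r ω) 0) P := (S.intX r).pos_part.const_mul 4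
    refine ⟨hi, ?_⟩
    rw [integral_const_mul]
    have : ∫ ω, max (X r ω) 0 ∂P ≤ ∫ ω, |X r ω| ∂P :=
      integral_mono (S.intX r).pos_part (S.intX r).abs fun ω => max_le (le_abs_self _) (abs_nonneg _)
    linarith [hC r hr.2]

theorem intM2 (S : Sol P ℱ δ x X) (t : ℝ) : Integrable (fun ω => cM δ x X t ω ^ 2) P := by
  refine ((S.martN.integrable t).add (S.intV t)).congr (Eventually.of_forall fun ω => ?_)
  simp

theorem memM (S : Sol P ℱ δ x X) (t : ℝ) : MemLp (cM δ x X t) 2 P :=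
  (memLp_two_iff_integrable_sq (S.meas_cM' t).aestronglyMeasurable).2 (S.intM2 t)

theorem memX (S : Sol P ℱ δ x X) (t : ℝ) : MemLp (X t) 2 P := by
  have := ((S.memM t).add (memLp_const (p := 2) (μ := P) x)).add (memLp_const (δ * max t 0))
  refine this.ae_eq (Eventually.of_forall fun ω => ?_)
  simp [cM]; ring

theorem intX2 (S : Sol P ℱ δ x X) (t : ℝ) : Integrable (fun ω => X t ω ^ 2) P := (S.memX t).integrable_sq

theorem memD (S : Sol P ℱ δ x X) (a b : ℝ) : MemLp (fun ω => cM δ x X b ω - cM δ x X a ω) 2 P :=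
  (S.memM b).sub (S.memM a)

theorem intD2 (S : Sol P ℱ δ x X) (a b : ℝ) : Integrable (fun ω => (cM δ x X b ω - cM δ x X a ω) ^ 2) P :=
  (S.memD a b).integrable_sq

end Sol
end

set_option linter.unusedSectionVars false
section
variable {Ω : Type*} [m : MeasurableSpace Ω] {P : Measure Ω} [IsProbabilityMeasure P]
    {ℱ : Filtration ℝ m}

theorem int_smul_bdd {F : Type*} [NormedAddCommGroup F] [NormedSpace ℝ F]
    {f : Ω → ℝ} (hf : Integrable f P) {Z : Ω → F} (hZ : AEStronglyMeasurable Z P) {K : ℝ}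
    (hK : ∀ ω, ‖Z ω‖ ≤ K) : Integrable (fun ω => f ω • Z ω) P := by
  refine (hf.norm.mul_const K).mono' (hf.aestronglyMeasurable.smul hZ)
    (Eventually.of_forall fun ω => ?_)
  rw [norm_smul]
  exact mul_le_mul_of_nonneg_left (hK ω) (norm_nonneg _)

namespace Sol
variable {δ x : ℝ} {X : ℝ → Ω → ℝ}

theorem intDV (S : Sol P ℱ δ x X) (a b : ℝ) :
    Integrable (fun ω => cV X b ω - cV X a ω) P := (S.intV b).sub (S.intV a)

theorem E1 (S : Sol P ℱ δ x X) {F : Type*} [NormedAddCommGroup F] [NormedSpace ℝ F]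
    [CompleteSpace F] {a b : ℝ} (hab : a ≤ b) {Z : Ω → F}
    (hZ : StronglyMeasurable[ℱ a] Z) {K : ℝ} (hK : ∀ ω, ‖Z ω‖ ≤ K) :
    Integrable (fun ω => (cM δ x X b ω - cM δ x X a ω) • Z ω) P ∧
    ∫ ω, (cM δ x X b ω - cM δ x X a ω) • Z ω ∂P = 0 := by
  have hi := int_smul_bdd ((S.intM b).sub (S.intM a)) (hZ.mono (ℱ.le a)).aestronglyMeasurable hK
  exact ⟨hi, mart_mul S.martM hab hZ hi⟩

theorem E2 (S : Sol P ℱ δ x X) {F : Type*} [NormedAddCommGroup F] [NormedSpace ℝ F]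
    [CompleteSpace F] {a b : ℝ} (hab : a ≤ b) {Z : Ω → F}
    (hZ : StronglyMeasurable[ℱ a] Z) {K : ℝ} (hK : ∀ ω, ‖Z ω‖ ≤ K) :
    Integrable (fun ω => ((cM δ x X b ω - cM δ x X a ω) ^ 2 - (cV X b ω - cV X a ω)) • Z ω) P ∧
    ∫ ω, ((cM δ x X b ω - cM δ x X a ω) ^ 2 - (cV X b ω - cV X a ω)) • Z ω ∂P = 0 := by
  have hZ' : AEStronglyMeasurable Z P := (hZ.mono (ℱ.le a)).aestronglyMeasurable
  have i1 : Integrable (fun ω => (((cM δ x X b ω) ^ 2 - cV X b ω) -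
      ((cM δ x X a ω) ^ 2 - cV X a ω)) • Z ω) P := int_smul_bdd ((S.martN.integrable b).sub (S.martN.integrable a)) hZ' hK
  have z1 := mart_mul S.martN hab hZ i1
  have hMZ : StronglyMeasurable[ℱ a] (fun ω => (2 * cM δ x X a ω) • Z ω) :=
    ((S.meas_cM a).const_mul 2).stronglyMeasurable.smul hZ
  have i2 : Integrable (fun ω => (cM δ x X b ω - cM δ x X a ω) • (2 * cM δ x X a ω) • Z ω) P := by
    have : Integrable (fun ω => (cM δ x X b ω - cM δ x X a ω) * (2 * cM δ x X a ω)) P :=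
      (S.memD a b).integrable_mul ((S.memM a).const_mul 2)
    refine (int_smul_bdd this hZ' hK).congr (Eventually.of_forall fun ω => ?_)
    simp only [smul_smul]
  have z2 := mart_mul S.martM hab hMZ i2
  have e : ∀ ω, ((cM δ x X b ω - cM δ x X a ω) ^ 2 - (cV X b ω - cV X a ω)) • Z ω =
      (((cM δ x X b ω) ^ 2 - cV X b ω) - ((cM δ x X a ω) ^ 2 - cV X a ω)) • Z ω
      - (cM δ x X b ω - cM δ x X a ω) • (2 * cM δ x X a ω) • Z ω := by
    intro ω
    rw [smul_smul, ← sub_smul]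
    congr 1
    ring
  simp only [e]
  refine ⟨i1.sub i2, ?_⟩
  rw [integral_sub i1 i2, z1, z2, sub_zero]

theorem ED2_eq (S : Sol P ℱ δ x X) {a b : ℝ} (hab : a ≤ b) {A : Set Ω}
    (hA : MeasurableSet[ℱ a] A) :
    ∫ ω in A, (cM δ x X b ω - cM δ x X a ω) ^ 2 ∂P = ∫ ω in A, (cV X b ω - cV X a ω) ∂P := by
  have hA' : MeasurableSet A := ℱ.le a _ hA
  have h := (S.E2 hab (Z := A.indicator fun _ => (1 : ℝ))
    (stronglyMeasurable_const.indicator hA) (K := 1) (fun ω => by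
      by_cases h : ω ∈ A <;> simp [h])).2
  have e : (fun ω => ((cM δ x X b ω - cM δ x X a ω) ^ 2 - (cV X b ω - cV X a ω)) •
      A.indicator (fun _ => (1 : ℝ)) ω) =
      A.indicator (fun ω => (cM δ x X b ω - cM δ x X a ω) ^ 2 - (cV X b ω - cV X a ω)) := by
    ext ω
    by_cases h : ω ∈ A <;> simp [h]
  rw [e, integral_indicator hA', integral_sub (S.intD2 a b).integrableOn
    (S.intDV a b).integrableOn] at h
  linarith

theorem cV_sub (S : Sol P ℱ δ x X) {a b : ℝ} (ha : 0 ≤ a) (hab : a ≤ b) (ω : Ω) :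
    cV X b ω - cV X a ω = ∫ r in Set.Ioc a b, 4 * max (X r ω) 0 := by
  have hc : Continuous fun r => 4 * max (X r ω) 0 :=
    continuous_const.mul ((S.cont ω).max continuous_const)
  unfold cV
  rw [← Set.Ioc_union_Ioc_eq_Ioc ha hab, setIntegral_union (Set.Ioc_disjoint_Ioc_of_le le_rfl)
    measurableSet_Ioc (hc.integrableOn_Ioc) (hc.integrableOn_Ioc)]
  ring

theorem cV_nonneg (S : Sol P ℱ δ x X) {a b : ℝ} (ha : 0 ≤ a) (hab : a ≤ b) (ω : Ω) :
    0 ≤ cV X b ω - cV X a ω := by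
  rw [S.cV_sub ha hab]
  exact integral_nonneg fun r => by positivity

theorem cV_mono (S : Sol P ℱ δ x X) {a s b : ℝ} (ha : 0 ≤ a) (has : a ≤ s) (ω : Ω) :
    cV X b ω - cV X s ω ≤ cV X b ω - cV X a ω := by
  linarith [S.cV_nonneg ha has ω]

/-- Moment bounds. -/
theorem bdds (S : Sol P ℱ δ x X) (T : ℝ) : ∃ C > 0,
    (∀ a b, 0 ≤ a → a ≤ b → b ≤ T →
      ∫ ω, (cM δ x X b ω - cM δ x X a ω) ^ 2 ∂P ≤ C * (b - a)) ∧
    (∀ t, 0 ≤ t → t ≤ T → ∫ ω, X t ω ^ 2 ∂P ≤ C) := by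
  obtain ⟨C, hC⟩ := S.bddX T
  have key : ∀ a b, 0 ≤ a → a ≤ b → b ≤ T →
      ∫ ω, (cM δ x X b ω - cM δ x X a ω) ^ 2 ∂P ≤ (4 * C) * (b - a) := by
    intro a b ha hab hb
    have h1 := S.ED2_eq hab (A := Set.univ) MeasurableSet.univ
    simp only [Measure.restrict_univ] at h1
    rw [h1]
    simp only [S.cV_sub ha hab]
    rw [mul_comm]
    refine (fub (Z := fun s ω => 4 * max (X s ω) 0) (C := 4 * C) ?_ ?_ hab ?_).2
    · exact (S.measU.max measurable_const).const_mul _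
    · intro r ω; positivity
    · intro r hr
      have hi : Integrable (fun ω => 4 * max (X r ω) 0) P := (S.intX r).pos_part.const_mul 4
      refine ⟨hi, ?_⟩
      rw [integral_const_mul]
      have : ∫ ω, max (X r ω) 0 ∂P ≤ ∫ ω, |X r ω| ∂P :=
        integral_mono (S.intX r).pos_part (S.intX r).abs
          fun ω => max_le (le_abs_self _) (abs_nonneg _)
      linarith [hC r (hr.2.trans hb)]
  have key2 : ∀ t, 0 ≤ t → t ≤ T → ∫ ω, X t ω ^ 2 ∂P
      ≤ 2 * ((4 * |C|) * |T|) + 2 * (|x| + |δ| * |T|) ^ 2 := by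
    intro t ht hT
    have h1 := key 0 t le_rfl ht hT
    have h2 : ∫ ω, X t ω ^ 2 ∂P ≤ ∫ ω, (2 * (cM δ x X t ω - cM δ x X 0 ω) ^ 2
        + 2 * (|x| + |δ| * |T|) ^ 2) ∂P := by
      refine integral_mono (S.intX2 t) (((S.intD2 0 t).const_mul 2).add (integrable_const _))
        fun ω => ?_
      have e : X t ω = (cM δ x X t ω - cM δ x X 0 ω) + (x + δ * t) := by
        simp [cM, S.init, ht]
      have h3 : |x + δ * t| ≤ |x| + |δ| * |T| := by
        refine (abs_add_le _ _).trans ?_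
        rw [abs_mul]
        have : |t| ≤ |T| := by rw [abs_of_nonneg ht]; exact hT.trans (le_abs_self T)
        gcongr
      have h4 : (x + δ * t) ^ 2 ≤ (|x| + |δ| * |T|) ^ 2 := sq_le_sq' (abs_le.1 h3).1 (abs_le.1 h3).2
      simp only
      rw [e]
      nlinarith [sq_nonneg ((cM δ x X t ω - cM δ x X 0 ω) - (x + δ * t))]
    rw [integral_add ((S.intD2 0 t).const_mul 2) (integrable_const _), integral_const_mul] at h2
    simp at h2
    have h5 : 4 * C * (t - 0) ≤ 4 * |C| * |T| := by
      have : |t| ≤ |T| := by rw [abs_of_nonneg ht]; exact hT.trans (le_abs_self T)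
      rw [sub_zero]
      calc 4 * C * t ≤ 4 * |C| * |t| := by
            have := le_abs_self (C * t)
            rw [abs_mul] at this
            linarith
        _ ≤ _ := by gcongr
    linarith
  refine ⟨4 * |C| + (2 * ((4 * |C|) * |T|) + 2 * (|x| + |δ| * |T|) ^ 2) + 1, by positivity, ?_, ?_⟩
  · intro a b ha hab hb
    refine (key a b ha hab hb).trans ?_
    refine mul_le_mul_of_nonneg_right ?_ (by linarith)
    have : 0 ≤ 2 * ((4 * |C|) * |T|) + 2 * (|x| + |δ| * |T|) ^ 2 := by positivity
    linarith [le_abs_self C]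
  · intro t ht hT
    have := key2 t ht hT
    have : 0 ≤ 4 * |C| := by positivity
    linarith

/-- `E[1_U ΔV]` bound. -/
theorem V1 (S : Sol P ℱ δ x X) {T C : ℝ} (hC : ∀ t, 0 ≤ t → t ≤ T → ∫ ω, X t ω ^ 2 ∂P ≤ C)
    {a b : ℝ} (ha : 0 ≤ a) (hab : a ≤ b) (hb : b ≤ T) {U : Set Ω} (hU : MeasurableSet U)
    {K : ℝ} (hK : 0 < K) :
    ∫ ω in U, (cV X b ω - cV X a ω) ∂P ≤ (b - a) * (4 * (C / K + K * P.real U)) := by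
  rw [← integral_indicator hU]
  have e : (U.indicator fun ω => cV X b ω - cV X a ω) =
      fun ω => ∫ r in Set.Ioc a b, U.indicator (fun ω => 4 * max (X r ω) 0) ω := by
    ext ω
    by_cases h : ω ∈ U
    · simp only [h, Set.indicator_of_mem]; exact S.cV_sub ha hab ω
    · simp [h]
  rw [e]
  refine (fub (Z := fun r => U.indicator (fun ω => 4 * max (X r ω) 0)) ?_ ?_ hab ?_).2
  · have : (fun p : ℝ × Ω => U.indicator (fun ω => 4 * max (X p.1 ω) 0) p.2) =
        (Prod.snd ⁻¹' U).indicator (fun p : ℝ × Ω => 4 * max (X p.1 p.2) 0) := by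
      ext p; rfl
    rw [this]
    exact ((S.measU.max measurable_const).const_mul 4).indicator (measurable_snd hU)
  · intro r ω
    exact Set.indicator_nonneg (fun ω _ => by positivity) ω
  · intro r hr
    have hi : Integrable (fun ω => 4 * max (X r ω) 0) P := (S.intX r).pos_part.const_mul 4
    have hi2 : Integrable (fun ω => (4 / K) * X r ω ^ 2) P := (S.intX2 r).const_mul _
    have hi3 : Integrable (U.indicator fun _ => 4 * K) P := (integrable_const _).indicator hU
    refine ⟨hi.indicator hU, ?_⟩
    calc _ ≤ ∫ ω, ((4 / K) * X r ω ^ 2 + U.indicator (fun _ => 4 * K) ω) ∂P := by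
          refine integral_mono (hi.indicator hU) (hi2.add hi3) fun ω => ?_
          by_cases h : ω ∈ U
          · simp only [h, Set.indicator_of_mem]
            have h1 : max (X r ω) 0 * K ≤ X r ω ^ 2 + K ^ 2 := by
              rcases le_total 0 (X r ω) with h0 | h0
              · rw [max_eq_left h0]; nlinarith [sq_nonneg (X r ω - K)]
              · rw [max_eq_right h0]; nlinarith [sq_nonneg (X r ω), sq_nonneg K]
            rw [show 4 / K * X r ω ^ 2 + 4 * K = 4 * (X r ω ^ 2 + K ^ 2) / K by field_simp,
              le_div_iff₀ hK]
            linarith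
          · simp only [h, not_false_eq_true, Set.indicator_of_notMem]
            positivity
      _ = (4 / K) * ∫ ω, X r ω ^ 2 ∂P + 4 * K * P.real U := by
          rw [integral_add hi2 hi3, integral_const_mul, integral_indicator hU]
          simp [mul_comm]
      _ ≤ (4 / K) * C + 4 * K * P.real U := by
          gcongr
          exact hC r (ha.trans hr.1.le) (hr.2.trans hb)
      _ = _ := by ring

/-- `ΔV` is close to `4 h X_a^+`. -/
theorem V2 (S : Sol P ℱ δ x X) (T : ℝ) {η : ℝ} (hη : 0 < η) : ∃ h0 > 0, ∀ a b, 0 ≤ a → a ≤ b →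
    b ≤ T → b - a ≤ h0 →
    Integrable (fun ω => |cV X b ω - cV X a ω - 4 * (b - a) * max (X a ω) 0|) P ∧
    ∫ ω, |cV X b ω - cV X a ω - 4 * (b - a) * max (X a ω) 0| ∂P ≤ η * (b - a) := by
  obtain ⟨C, hC0, hC, -⟩ := S.bdds T
  set κ := η / 12 with hκ
  have hκ0 : 0 < κ := by positivity
  refine ⟨min (κ ^ 2 / C) (κ / (|δ| + 1)), by positivity, fun a b ha hab hb hh => ?_⟩
  have hI : Integrable (fun ω => |cV X b ω - cV X a ω - 4 * (b - a) * max (X a ω) 0|) P :=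
    ((S.intDV a b).sub ((S.intX a).pos_part.const_mul _)).abs
  refine ⟨hI, ?_⟩
  have hf := fub (P := P) (Z := fun r ω => 4 * |X r ω - X a ω|) (C := η) ?_ ?_ hab ?_
  · rw [mul_comm η]
    refine le_trans (integral_mono hI hf.1 fun ω => ?_) hf.2
    simp only
    have e : cV X b ω - cV X a ω - 4 * (b - a) * max (X a ω) 0
        = ∫ r in Set.Ioc a b, (4 * max (X r ω) 0 - 4 * max (X a ω) 0) := by
      rw [integral_sub, S.cV_sub ha hab]
      · simp [hab]; ring
      · exact (continuous_const.mul ((S.cont ω).max continuous_const)).integrableOn_Ioc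
      · exact continuous_const.integrableOn_Ioc
    rw [e]
    refine (abs_integral_le_integral_abs).trans ?_
    refine integral_mono (Continuous.integrableOn_Ioc ?_) (Continuous.integrableOn_Ioc ?_) ?_
    · exact ((continuous_const.mul ((S.cont ω).max continuous_const)).sub continuous_const).abs
    · exact continuous_const.mul ((S.cont ω).sub continuous_const).abs
    · intro r
      simp only
      rw [← mul_sub, abs_mul, abs_of_pos (by norm_num : (0:ℝ) < 4)]
      have := abs_max_sub_max_le_abs (X r ω) (X a ω) 0
      linarith
  · exact ((S.measU.sub ((S.meas' a).comp measurable_snd)).abs).const_mul 4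
  · intro r ω; positivity
  · intro r hr
    have hi : Integrable (fun ω => 4 * |X r ω - X a ω|) P :=
      ((S.intX r).sub (S.intX a)).abs.const_mul 4
    refine ⟨hi, ?_⟩
    have hra : r - a ≤ b - a := by linarith [hr.2]
    have hra0 : 0 ≤ r - a := by linarith [hr.1]
    have h1 : C * (r - a) ≤ κ ^ 2 := by
      have : r - a ≤ κ ^ 2 / C := hra.trans (hh.trans (min_le_left _ _))
      rw [le_div_iff₀ hC0] at this
      linarith
    have h2 : |δ| * (r - a) ≤ κ := by
      have : r - a ≤ κ / (|δ| + 1) := hra.trans (hh.trans (min_le_right _ _))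
      rw [le_div_iff₀ (by positivity)] at this
      linarith
    calc _ ≤ ∫ ω, (4 * ((cM δ x X r ω - cM δ x X a ω) ^ 2 / κ) + 8 * κ) ∂P := by
          refine integral_mono hi ((((S.intD2 a r).div_const κ).const_mul 4).add
            (integrable_const _)) fun ω => ?_
          simp only
          have e : X r ω - X a ω = (cM δ x X r ω - cM δ x X a ω) + δ * (r - a) := by
            simp only [cM, max_eq_left ha, max_eq_left (ha.trans hr.1.le)]; ring
          have h3 : |X r ω - X a ω| ≤ |cM δ x X r ω - cM δ x X a ω| + κ := by
            rw [e]
            refine (abs_add_le _ _).trans ?_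
            rw [abs_mul, abs_of_nonneg hra0]
            linarith
          have h4 : |cM δ x X r ω - cM δ x X a ω| ≤ (cM δ x X r ω - cM δ x X a ω) ^ 2 / κ + κ := by
            rw [← sq_abs (cM δ x X r ω - cM δ x X a ω)]
            rw [div_add' _ _ _ hκ0.ne', le_div_iff₀ hκ0]
            nlinarith [sq_nonneg (|cM δ x X r ω - cM δ x X a ω| - κ), abs_nonneg (cM δ x X r ω - cM δ x X a ω)]
          linarith
      _ = 4 * ((∫ ω, (cM δ x X r ω - cM δ x X a ω) ^ 2 ∂P) / κ) + 8 * κ := by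
          rw [integral_add (((S.intD2 a r).div_const κ).const_mul 4) (integrable_const _),
            integral_const_mul, integral_div]
          simp
      _ ≤ 4 * (κ ^ 2 / κ) + 8 * κ := by
          gcongr
          exact (hC a r ha hr.1.le (hr.2.trans hb)).trans h1
      _ = η := by
          rw [hκ]; field_simp; ring

end Sol
end

set_option linter.unusedSectionVars false
section
variable {Ω : Type*} [m : MeasurableSpace Ω] {P : Measure Ω} [IsProbabilityMeasure P]
    {ℱ : Filtration ℝ m}

namespace Sol
variable {δ x : ℝ} {X : ℝ → Ω → ℝ}

theorem sub_mart (S : Sol P ℱ δ x X) {a s b : ℝ} (has : a ≤ s) (hsb : s ≤ b) {A : Set Ω}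
    (hA : MeasurableSet[ℱ s] A) :
    ∫ ω in A, (cM δ x X s ω - cM δ x X a ω) ^ 2 ∂P ≤
      ∫ ω in A, (cM δ x X b ω - cM δ x X a ω) ^ 2 ∂P := by
  have hA' : MeasurableSet A := ℱ.le s _ hA
  set Z : Ω → ℝ := A.indicator (fun ω => 2 * (cM δ x X s ω - cM δ x X a ω)) with hZ
  have hZm : StronglyMeasurable[ℱ s] Z :=
    ((((S.meas_cM s).sub ((S.meas_cM a).mono (ℱ.mono has) le_rfl)).const_mul 2).indicator
      hA).stronglyMeasurable
  have hZ2 : MemLp Z 2 P := ((S.memD a s).const_mul 2).indicator hA'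
  have hi : Integrable (fun ω => (cM δ x X b ω - cM δ x X s ω) • Z ω) P :=
    (S.memD s b).integrable_mul hZ2
  have h0 := mart_mul S.martM hsb hZm hi
  have e : (fun ω => (cM δ x X b ω - cM δ x X s ω) • Z ω) =
      A.indicator (fun ω => 2 * (cM δ x X b ω - cM δ x X s ω) *
        (cM δ x X s ω - cM δ x X a ω)) := by
    ext ω
    by_cases h : ω ∈ A
    · simp [hZ, h]; ring
    · simp [hZ, h]
  rw [e] at hi h0
  rw [integral_indicator hA'] at h0
  have hi' := (integrable_indicator_iff hA').1 hi
  have h1 : ∫ ω in A, (cM δ x X s ω - cM δ x X a ω) ^ 2 ∂P ≤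
      ∫ ω in A, ((cM δ x X b ω - cM δ x X a ω) ^ 2 - 2 * (cM δ x X b ω - cM δ x X s ω) *
        (cM δ x X s ω - cM δ x X a ω)) ∂P := by
    refine setIntegral_mono (S.intD2 a s).integrableOn ((S.intD2 a b).integrableOn.sub hi')
      fun ω => ?_
    have : (0:ℝ) ≤ (cM δ x X b ω - cM δ x X s ω) ^ 2 := sq_nonneg _
    simp only
    linarith
  rw [integral_sub (S.intD2 a b).integrableOn hi', h0, sub_zero] at h1
  exact h1

theorem grid (S : Sol P ℱ δ x X) {T C : ℝ} (hC0 : 0 < C)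
    (hC1 : ∀ a b, 0 ≤ a → a ≤ b → b ≤ T →
      ∫ ω, (cM δ x X b ω - cM δ x X a ω) ^ 2 ∂P ≤ C * (b - a))
    (hC2 : ∀ t, 0 ≤ t → t ≤ T → ∫ ω, X t ω ^ 2 ∂P ≤ C)
    {ε : ℝ} (hε : 0 < ε) {K : ℝ} (hK : 0 < K) {a b : ℝ} (ha : 0 ≤ a) (hab : a ≤ b) (hb : b ≤ T)
    (s : ℕ → ℝ) (hs : Monotone s) (N : ℕ) (hs0 : s 0 = a) (hsN : s N = b) :
    ∫ ω in {ω | 4 * ε < |cM δ x X b ω - cM δ x X a ω|}, (cM δ x X b ω - cM δ x X a ω) ^ 2 ∂P ≤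
    ∫ ω in {ω | ∃ j < N, ε < |cM δ x X (s (j + 1)) ω - cM δ x X (s j) ω|},
      (cM δ x X b ω - cM δ x X a ω) ^ 2 ∂P
      + 4 * ((b - a) * (4 * (C / K + K * (C * (b - a) / ε ^ 2)))) := by
  set M := cM δ x X with hM
  set A : ℕ → Set Ω := fun j => {ω | ε < |M (s j) ω - M a ω| ∧ ∀ i < j, |M (s i) ω - M a ω| ≤ ε}
    with hA
  have has : ∀ j, a ≤ s j := fun j => hs0 ▸ hs (Nat.zero_le j)
  have hsb : ∀ j ∈ Finset.range (N + 1), s j ≤ b := fun j hj => by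
    rw [← hsN]; exact hs (Nat.lt_succ_iff.1 (Finset.mem_range.1 hj))
  have hMm : ∀ i j, i ≤ j → Measurable[ℱ (s j)] (fun ω => |M (s i) ω - M a ω|) := fun i j hij =>
    continuous_abs.measurable.comp (((S.meas_cM (s i)).mono (ℱ.mono (hs hij)) le_rfl).sub
      ((S.meas_cM a).mono (ℱ.mono (has j)) le_rfl))
  have hAm : ∀ j, MeasurableSet[ℱ (s j)] (A j) := by
    intro j
    have e : A j = {ω | ε < |M (s j) ω - M a ω|} ∩ ⋂ i, ⋂ (_ : i < j), {ω | |M (s i) ω - M a ω| ≤ ε} := by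
      ext ω; simp [hA]
    rw [e]
    refine MeasurableSet.inter (measurableSet_lt measurable_const (hMm j j le_rfl)) ?_
    exact MeasurableSet.iInter fun i => MeasurableSet.iInter fun hi =>
      measurableSet_le (hMm i j hi.le) measurable_const
  have hAm' : ∀ j, MeasurableSet (A j) := fun j => ℱ.le _ _ (hAm j)
  have hdis : Pairwise (Function.onFun Disjoint A) := by
    have aux : ∀ i j, i < j → Disjoint (A i) (A j) := by
      intro i j hij
      rw [Set.disjoint_left]
      rintro ω ⟨h1, -⟩ ⟨-, h2⟩
      exact absurd (h2 i hij) (not_le.2 h1)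
    intro i j hij
    rcases lt_or_gt_of_ne hij with h | h
    · exact aux i j h
    · exact (aux j i h).symm
  set U : Set Ω := ⋃ j ∈ Finset.range (N + 1), A j with hU
  have hUm : MeasurableSet U := Finset.measurableSet_biUnion _ fun j _ => hAm' j
  have hsum : ∀ f : Ω → ℝ, Integrable f P →
      ∫ ω in U, f ω ∂P = ∑ j ∈ Finset.range (N + 1), ∫ ω in A j, f ω ∂P := by
    intro f hf
    exact integral_biUnion_finset _ (fun j _ => hAm' j) (fun i _ j _ hij => hdis hij)
      (fun j _ => hf.integrableOn)
  -- probability bound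
  have hPU : P.real U ≤ C * (b - a) / ε ^ 2 := by
    rw [le_div_iff₀ (by positivity)]
    have h1 : ∀ j ∈ Finset.range (N + 1), ε ^ 2 * P.real (A j) ≤
        ∫ ω in A j, (M b ω - M a ω) ^ 2 ∂P := by
      intro j hj
      refine le_trans ?_ (S.sub_mart (has j) (hsb j hj) (hAm j))
      have : ε ^ 2 * P.real (A j) = ∫ ω in A j, ε ^ 2 ∂P := by simp [mul_comm]
      rw [this]
      refine setIntegral_mono_on (integrable_const _) (S.intD2 a (s j)).integrableOn (hAm' j) ?_
      intro ω hω
      have h := hω.1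
      rw [← sq_abs (cM δ x X (s j) ω - cM δ x X a ω)]
      exact pow_le_pow_left₀ hε.le h.le 2
    have h2 : P.real U = ∑ j ∈ Finset.range (N + 1), P.real (A j) := by
      have := hsum (fun _ => 1) (integrable_const _)
      simpa using this
    have h3 : ∫ ω in U, (M b ω - M a ω) ^ 2 ∂P ≤ C * (b - a) :=
      (setIntegral_le_integral (S.intD2 a b) (Eventually.of_forall fun ω => sq_nonneg _)).trans
        (hC1 a b ha hab hb)
    rw [hsum _ (S.intD2 a b)] at h3
    rw [h2, Finset.sum_mul]
    refine le_trans (Finset.sum_le_sum fun j hj => ?_) h3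
    rw [mul_comm]
    exact h1 j hj
  have hV : ∑ j ∈ Finset.range (N + 1), ∫ ω in A j, (M b ω - M (s j) ω) ^ 2 ∂P ≤
      (b - a) * (4 * (C / K + K * (C * (b - a) / ε ^ 2))) := by
    calc _ ≤ ∑ j ∈ Finset.range (N + 1), ∫ ω in A j, (cV X b ω - cV X a ω) ∂P := by
          refine Finset.sum_le_sum fun j hj => ?_
          rw [S.ED2_eq (hsb j hj) (hAm j)]
          refine setIntegral_mono (S.intDV _ _).integrableOn (S.intDV _ _).integrableOn fun ω => ?_
          exact S.cV_mono ha (has j) ω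
      _ = ∫ ω in U, (cV X b ω - cV X a ω) ∂P := (hsum _ (S.intDV a b)).symm
      _ ≤ (b - a) * (4 * (C / K + K * P.real U)) := S.V1 hC2 ha hab hb hUm hK
      _ ≤ _ := by
          have : 0 ≤ b - a := by linarith
          gcongr
  set B : Set Ω := {ω | ∃ j < N, ε < |M (s (j + 1)) ω - M (s j) ω|} with hB
  have hBm : MeasurableSet B := by
    have e : B = ⋃ j, ⋃ (_ : j < N), {ω | ε < |M (s (j + 1)) ω - M (s j) ω|} := by
      ext ω; simp [hB]
    rw [e]
    exact MeasurableSet.iUnion fun j => MeasurableSet.iUnion fun _ =>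
      measurableSet_lt measurable_const ((S.meas_cM' _).sub (S.meas_cM' _)).abs
  have hGm : MeasurableSet {ω | 4 * ε < |M b ω - M a ω|} :=
    measurableSet_lt measurable_const ((S.meas_cM' _).sub (S.meas_cM' _)).abs
  have hfin : ∀ j ∈ Finset.range (N + 1),
      Integrable ((A j).indicator fun ω => 4 * (M b ω - M (s j) ω) ^ 2) P := fun j _ =>
    ((S.intD2 (s j) b).const_mul 4).indicator (hAm' j)
  calc _ = ∫ ω, ({ω | 4 * ε < |M b ω - M a ω|}.indicator fun ω => (M b ω - M a ω) ^ 2) ω ∂P :=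
        (integral_indicator hGm).symm
    _ ≤ ∫ ω, (B.indicator (fun ω => (M b ω - M a ω) ^ 2) ω +
        ∑ j ∈ Finset.range (N + 1), (A j).indicator (fun ω => 4 * (M b ω - M (s j) ω) ^ 2) ω) ∂P := by
        refine integral_mono ((S.intD2 a b).indicator hGm) (((S.intD2 a b).indicator hBm).add
          (integrable_finsetSum _ hfin)) fun ω => ?_
        have hpos : ∀ j ∈ Finset.range (N + 1),
            0 ≤ (A j).indicator (fun ω => 4 * (M b ω - M (s j) ω) ^ 2) ω := fun j _ =>
          Set.indicator_nonneg (fun ω _ => by positivity) ω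
        have hpos2 : 0 ≤ B.indicator (fun ω => (M b ω - M a ω) ^ 2) ω :=
          Set.indicator_nonneg (fun ω _ => by positivity) ω
        by_cases hG : 4 * ε < |M b ω - M a ω|
        swap
        · rw [Set.indicator_of_notMem (by exact hG)]
          exact add_nonneg hpos2 (Finset.sum_nonneg hpos)
        rw [Set.indicator_of_mem (by exact hG)]
        by_cases hBω : ω ∈ B
        · rw [Set.indicator_of_mem hBω]
          linarith [Finset.sum_nonneg hpos]
        · rw [Set.indicator_of_notMem hBω, zero_add]
          have hex : ∃ j, ε < |M (s j) ω - M a ω| := ⟨N, by rw [hsN]; linarith⟩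
          classical
          set j := Nat.find hex with hj
          have hj1 : ε < |M (s j) ω - M a ω| := Nat.find_spec hex
          have hj2 : ∀ i < j, |M (s i) ω - M a ω| ≤ ε := fun i hi => not_lt.1 (Nat.find_min hex hi)
          have hjN : j ≤ N := Nat.find_min' hex (by rw [hsN]; linarith)
          have hj0 : j ≠ 0 := by
            intro h0
            rw [h0, hs0] at hj1
            simp at hj1
            linarith
          obtain ⟨i, hi⟩ := Nat.exists_eq_succ_of_ne_zero hj0
          have h1 := hj2 i (by omega)
          have h2 : |M (s j) ω - M (s i) ω| ≤ ε := by
            by_contra hcon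
            exact hBω ⟨i, by omega, by rw [← Nat.succ_eq_add_one, ← hi]; exact not_le.1 hcon⟩
          have hjA : ω ∈ A j := ⟨hj1, hj2⟩
          have hjr : j ∈ Finset.range (N + 1) := Finset.mem_range.2 (by omega)
          refine le_trans ?_ (Finset.single_le_sum hpos hjr)
          rw [Set.indicator_of_mem hjA]
          have h3 : |M b ω - M a ω| ≤ 2 * |M b ω - M (s j) ω| := by
            have t1 := abs_add_le (M b ω - M (s j) ω) (M (s j) ω - M a ω)
            have t2 := abs_add_le (M (s j) ω - M (s i) ω) (M (s i) ω - M a ω)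
            rw [sub_add_sub_cancel] at t1 t2
            linarith
          have h4 := pow_le_pow_left₀ (abs_nonneg _) h3 2
          rw [mul_pow, sq_abs, sq_abs] at h4
          linarith
    _ = ∫ ω in B, (M b ω - M a ω) ^ 2 ∂P +
        4 * ∑ j ∈ Finset.range (N + 1), ∫ ω in A j, (M b ω - M (s j) ω) ^ 2 ∂P := by
        rw [integral_add ((S.intD2 a b).indicator hBm) (integrable_finsetSum _ hfin),
          integral_indicator hBm, integral_finsetSum _ hfin, Finset.mul_sum]
        congr 1
        refine Finset.sum_congr rfl fun j _ => ?_
        rw [integral_indicator (hAm' j), integral_const_mul]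
    _ ≤ _ := by linarith

theorem cM_cont (S : Sol P ℱ δ x X) (ω : Ω) : Continuous fun t => cM δ x X t ω := by
  unfold cM
  exact ((S.cont ω).sub continuous_const).sub
    (continuous_const.mul (continuous_id.max continuous_const))

theorem lind4 (S : Sol P ℱ δ x X) {T C : ℝ} (hC0 : 0 < C)
    (hC1 : ∀ a b, 0 ≤ a → a ≤ b → b ≤ T →
      ∫ ω, (cM δ x X b ω - cM δ x X a ω) ^ 2 ∂P ≤ C * (b - a))
    (hC2 : ∀ t, 0 ≤ t → t ≤ T → ∫ ω, X t ω ^ 2 ∂P ≤ C)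
    {ε : ℝ} (hε : 0 < ε) {K : ℝ} (hK : 0 < K) {a b : ℝ} (ha : 0 ≤ a) (hab : a ≤ b) (hb : b ≤ T) :
    ∫ ω in {ω | 4 * ε < |cM δ x X b ω - cM δ x X a ω|}, (cM δ x X b ω - cM δ x X a ω) ^ 2 ∂P ≤
      4 * ((b - a) * (4 * (C / K + K * (C * (b - a) / ε ^ 2)))) := by
  set s : ℕ → ℕ → ℝ := fun N j => a + j * ((b - a) / (N + 1)) with hs
  have hpos : ∀ N : ℕ, 0 ≤ (b - a) / ((N : ℝ) + 1) := fun N =>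
    div_nonneg (by linarith) (by positivity)
  set B : ℕ → Set Ω := fun N =>
    {ω | ∃ j < N + 1, ε < |cM δ x X (s N (j + 1)) ω - cM δ x X (s N j) ω|} with hB
  have hBm : ∀ N, MeasurableSet (B N) := by
    intro N
    have e : B N = ⋃ j, ⋃ (_ : j < N + 1),
        {ω | ε < |cM δ x X (s N (j + 1)) ω - cM δ x X (s N j) ω|} := by
      ext ω; simp [hB]
    rw [e]
    exact MeasurableSet.iUnion fun j => MeasurableSet.iUnion fun _ =>
      measurableSet_lt measurable_const ((S.meas_cM' _).sub (S.meas_cM' _)).abs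
  have hlim : Tendsto (fun N => ∫ ω, (B N).indicator
      (fun ω => (cM δ x X b ω - cM δ x X a ω) ^ 2) ω ∂P) atTop (nhds (∫ ω, (0 : ℝ) ∂P)) := by
    refine tendsto_integral_of_dominated_convergence
      (fun ω => (cM δ x X b ω - cM δ x X a ω) ^ 2) ?_ (S.intD2 a b) ?_ ?_
    · intro N
      exact ((S.intD2 a b).indicator (hBm N)).aestronglyMeasurable
    · intro N
      refine Eventually.of_forall fun ω => ?_
      refine (norm_indicator_le_norm_self _ _).trans ?_
      rw [Real.norm_of_nonneg (sq_nonneg _)]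
    · refine Eventually.of_forall fun ω => ?_
      refine tendsto_const_nhds.congr' ?_
      have huc : UniformContinuousOn (fun t => cM δ x X t ω) (Set.Icc a b) :=
        isCompact_Icc.uniformContinuousOn_of_continuous (S.cM_cont ω).continuousOn
      rw [Metric.uniformContinuousOn_iff] at huc
      obtain ⟨d, hd, hd'⟩ := huc ε hε
      have hN : Tendsto (fun N : ℕ => (b - a) / ((N : ℝ) + 1)) atTop (nhds 0) :=
        tendsto_const_nhds.div_atTop
          (tendsto_atTop_add_const_right _ _ tendsto_natCast_atTop_atTop)
      filter_upwards [hN.eventually (gt_mem_nhds hd)] with N hN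
      rw [Set.indicator_of_notMem]
      rintro ⟨j, hj, hj'⟩
      refine absurd (hd' (s N (j + 1)) ?_ (s N j) ?_ ?_) (not_lt.2 ?_)
      · have : ((j + 1 : ℕ) : ℝ) ≤ (N : ℝ) + 1 := by exact_mod_cast hj
        have h2 : ((j + 1 : ℕ) : ℝ) * ((b - a) / (N + 1)) ≤ (N + 1) * ((b - a) / (N + 1)) :=
          mul_le_mul_of_nonneg_right this (hpos N)
        rw [mul_div_cancel₀ _ (by positivity : (N : ℝ) + 1 ≠ 0)] at h2
        refine ⟨?_, ?_⟩
        · have := mul_nonneg (Nat.cast_nonneg (α := ℝ) (j + 1)) (hpos N)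
          simp only [hs]; linarith
        · simp only [hs]; linarith
      · have : (j : ℝ) ≤ (N : ℝ) + 1 := by exact_mod_cast hj.le
        have h2 : (j : ℝ) * ((b - a) / (N + 1)) ≤ (N + 1) * ((b - a) / (N + 1)) :=
          mul_le_mul_of_nonneg_right this (hpos N)
        rw [mul_div_cancel₀ _ (by positivity : (N : ℝ) + 1 ≠ 0)] at h2
        refine ⟨?_, ?_⟩
        · have := mul_nonneg (Nat.cast_nonneg (α := ℝ) j) (hpos N)
          simp only [hs]; linarith
        · simp only [hs]; linarith
      · simp only [hs, Real.dist_eq]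
        rw [show a + ((j + 1 : ℕ) : ℝ) * ((b - a) / (N + 1)) - (a + j * ((b - a) / (N + 1))) =
          (b - a) / (N + 1) by push_cast; ring, abs_of_nonneg (hpos N)]
        exact hN
      · rw [Real.dist_eq]; exact hj'.le
  rw [integral_zero] at hlim
  have hlim2 := hlim.add_const (4 * ((b - a) * (4 * (C / K + K * (C * (b - a) / ε ^ 2)))))
  rw [zero_add] at hlim2
  refine ge_of_tendsto' hlim2 fun N => ?_
  rw [integral_indicator (hBm N)]
  refine S.grid hC0 hC1 hC2 hε hK ha hab hb (s N) ?_ (N + 1) ?_ ?_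
  · intro i j hij
    simp only [hs]
    have := hpos N
    gcongr
  · simp [hs]
  · simp only [hs]
    push_cast
    rw [mul_div_cancel₀ _ (by positivity : (N : ℝ) + 1 ≠ 0)]
    ring

theorem lind (S : Sol P ℱ δ x X) (T : ℝ) {ε η : ℝ} (hε : 0 < ε) (hη : 0 < η) :
    ∃ h0 > 0, ∀ a b, 0 ≤ a → a ≤ b → b ≤ T → b - a ≤ h0 →
    ∫ ω in {ω | ε < |cM δ x X b ω - cM δ x X a ω|}, (cM δ x X b ω - cM δ x X a ω) ^ 2 ∂P
      ≤ η * (b - a) := by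
  obtain ⟨C, hC0, hC1, hC2⟩ := S.bdds T
  set K := 32 * C / η with hK
  have hK0 : 0 < K := by positivity
  refine ⟨η * (ε / 4) ^ 2 / (32 * K * C), by positivity, fun a b ha hab hb hh => ?_⟩
  have h := S.lind4 hC0 hC1 hC2 (ε := ε / 4) (by positivity) hK0 ha hab hb
  rw [show 4 * (ε / 4) = ε by ring] at h
  refine h.trans ?_
  rw [le_div_iff₀ (by positivity)] at hh
  have h1 : C / K = η / 32 := by rw [hK]; field_simp
  have h2 : K * (C * (b - a) / (ε / 4) ^ 2) ≤ η / 32 := by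
    rw [← mul_div_assoc, div_le_iff₀ (by positivity)]
    linarith
  have h3 : 0 ≤ b - a := by linarith
  calc 4 * ((b - a) * (4 * (C / K + K * (C * (b - a) / (ε / 4) ^ 2))))
      ≤ 4 * ((b - a) * (4 * (η / 32 + η / 32))) := by rw [h1]; gcongr
    _ = η * (b - a) := by ring

end Sol
end

set_option linter.unusedSectionVars false

theorem tele {u : ℝ → ℝ} {s T : ℝ} (hsT : s ≤ T)
    (H : ∀ η > 0, ∃ h0 > 0, ∀ a b, s ≤ a → a ≤ b → b ≤ T → b - a ≤ h0 →
      u b - u a ≤ η * (b - a)) : u T ≤ u s := by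
  have key : ∀ η > 0, u T - u s ≤ η * (T - s) := by
    intro η hη
    obtain ⟨h0, hh0, hh⟩ := H η hη
    obtain ⟨N, hN⟩ := exists_nat_ge ((T - s) / h0)
    set d := (T - s) / ((N : ℝ) + 1) with hd
    have hN1 : (0 : ℝ) < (N : ℝ) + 1 := by positivity
    have hd0 : 0 ≤ d := div_nonneg (by linarith) hN1.le
    have hdN : ((N : ℝ) + 1) * d = T - s := by rw [hd]; field_simp
    have hdh : d ≤ h0 := by
      rw [hd, div_le_iff₀ hN1]
      rw [div_le_iff₀ hh0] at hN
      nlinarith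
    have ind : ∀ j : ℕ, j ≤ N + 1 → u (s + j * d) - u s ≤ η * (j * d) := by
      intro j
      induction j with
      | zero => intro _; simp
      | succ j ih =>
        intro hj
        have h1 := ih (by omega)
        have hjN : ((j : ℝ) + 1) * d ≤ T - s := by
          rw [← hdN]
          have : (j : ℝ) + 1 ≤ (N : ℝ) + 1 := by exact_mod_cast hj
          exact mul_le_mul_of_nonneg_right this hd0
        have hj0 : 0 ≤ (j : ℝ) * d := by positivity
        have h2 := hh (s + j * d) (s + (j + 1 : ℕ) * d) (by linarith) (by push_cast; linarith)
          (by push_cast; linarith) (by push_cast; linarith)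
        push_cast at h2 ⊢
        have e : s + ((j : ℝ) + 1) * d - (s + j * d) = d := by ring
        rw [e] at h2
        nlinarith
    have := ind (N + 1) le_rfl
    push_cast at this
    rw [hdN] at this
    simpa using this
  by_contra hcon
  push Not at hcon
  have h1 := key ((u T - u s) / (2 * (T - s + 1))) (by
    have : 0 ≤ T - s := by linarith
    apply div_pos <;> linarith)
  rw [div_mul_eq_mul_div, le_div_iff₀ (by linarith)] at h1
  have : 0 ≤ T - s := by linarith
  nlinarith

theorem int6 {Ω : Type*} [MeasurableSpace Ω] {P : Measure Ω} [IsProbabilityMeasure P]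
    {f0 f1 f2 f3 f4 : Ω → ℝ} (h0 : Integrable f0 P) (h1 : Integrable f1 P) (h2 : Integrable f2 P)
    (h3 : Integrable f3 P) (h4 : Integrable f4 P) (c : ℝ) :
    ∫ ω, (((((f0 ω - f1 ω) + f2 ω) + f3 ω) + f4 ω) + c) ∂P =
      ∫ ω, f0 ω ∂P - ∫ ω, f1 ω ∂P + ∫ ω, f2 ω ∂P + ∫ ω, f3 ω ∂P + ∫ ω, f4 ω ∂P + c := by
  have e1 := integral_add ((((h0.sub h1).add h2).add h3).add h4) (integrable_const c)
  have e2 := integral_add (((h0.sub h1).add h2).add h3) h4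
  have e3 := integral_add ((h0.sub h1).add h2) h3
  have e4 := integral_add (h0.sub h1) h2
  have e5 := integral_sub h0 h1
  simp only [Pi.add_apply, Pi.sub_apply] at e1 e2 e3 e4 e5
  rw [e1, e2, e3, e4, e5]
  simp

theorem neg_pw {xa xb d dv h ε z g c : ℝ} (hh0 : 0 ≤ h) (hc0 : 0 ≤ c) (hε : 0 ≤ ε)
    (hXb : xb - xa = d + c) (hG0 : 0 ≤ g) (hz1 : xa ≤ ε → z = 1) (hz0 : ε < xa → z = 0)
    (hg : ε < |d| → d ^ 2 ≤ g) :
    (max (-xb) 0) ^ 2 ≤ (((((max (-xa) 0) ^ 2 - d * (2 * max (-xa) 0)) + (d ^ 2 - dv) * z)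
      + |dv - 4 * h * max xa 0|) + g) + 4 * h * ε := by
  have hab1 := le_abs_self (dv - 4 * h * max xa 0)
  have hab0 := abs_nonneg (dv - 4 * h * max xa 0)
  have hmono : (max (-xb) 0) ^ 2 ≤ (max (-(xa + d)) 0) ^ 2 := by
    refine pow_le_pow_left₀ (le_max_right _ _) ?_ 2
    exact max_le_max_right 0 (by linarith)
  refine hmono.trans ?_
  generalize |dv - 4 * h * max xa 0| = q at *
  have h5 : 0 ≤ 4 * h * ε := by positivity
  by_cases hc : xa ≤ ε
  · rw [hz1 hc]
    rcases le_total 0 xa with h0 | h0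
    · rw [max_eq_right (by linarith : -xa ≤ 0)]
      rw [max_eq_left h0] at hab1
      have h3 : (max (-(xa + d)) 0) ^ 2 ≤ d ^ 2 := by
        rcases le_total 0 (xa + d) with h4 | h4
        · rw [max_eq_right (by linarith)]; nlinarith [sq_nonneg d]
        · rw [max_eq_left (by linarith)]; nlinarith
      have h5 : 4 * h * xa ≤ 4 * h * ε := mul_le_mul_of_nonneg_left hc (by linarith)
      linarith
    · rw [max_eq_left (by linarith : 0 ≤ -xa)]
      rw [max_eq_right h0] at hab1
      have h3 : (max (-(xa + d)) 0) ^ 2 ≤ (xa + d) ^ 2 := by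
        rcases le_total 0 (xa + d) with h4 | h4
        · rw [max_eq_right (by linarith)]; simpa using sq_nonneg (xa + d)
        · rw [max_eq_left (by linarith)]; exact (neg_sq _).le
      linarith [show (xa + d) ^ 2 = (-xa) ^ 2 - d * (2 * (-xa)) + d ^ 2 by ring]
  · push Not at hc
    rw [hz0 hc, max_eq_right (by linarith : -xa ≤ 0)]
    rcases le_total 0 (xa + d) with h4 | h4
    · rw [max_eq_right (by linarith)]
      linarith
    · have hgd := hg (by rw [abs_of_nonpos (by linarith)]; linarith)
      rw [max_eq_left (by linarith)]
      have : (-(xa + d)) ^ 2 ≤ d ^ 2 := by nlinarith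
      linarith

section
variable {Ω : Type*} [m : MeasurableSpace Ω] {P : Measure Ω} [IsProbabilityMeasure P]
    {ℱ : Filtration ℝ m}
namespace Sol
variable {δ x : ℝ} {X : ℝ → Ω → ℝ}

theorem dX (S : Sol P ℱ δ x X) {a b : ℝ} (ha : 0 ≤ a) (hab : a ≤ b) (ω : Ω) :
    X b ω - X a ω = (cM δ x X b ω - cM δ x X a ω) + δ * (b - a) := by
  simp only [cM, max_eq_left ha, max_eq_left (ha.trans hab)]; ring

theorem memNeg (S : Sol P ℱ δ x X) (t : ℝ) : MemLp (fun ω => max (-X t ω) 0) 2 P := by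
  refine (S.memX t).mono ((S.meas' t).neg.max measurable_const).aestronglyMeasurable
    (Eventually.of_forall fun ω => ?_)
  rw [Real.norm_of_nonneg (le_max_right _ _)]
  exact max_le (neg_le_abs _) (abs_nonneg _)

theorem measGt (S : Sol P ℱ δ x X) (a b ε : ℝ) :
    MeasurableSet {ω | ε < |cM δ x X b ω - cM δ x X a ω|} :=
  measurableSet_lt measurable_const ((S.meas_cM' _).sub (S.meas_cM' _)).abs

set_option maxHeartbeats 1000000 in
theorem nonneg (S : Sol P ℱ δ x X) (hδ : 0 ≤ δ) (hx : 0 ≤ x) {T : ℝ} (hT : 0 ≤ T) :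
    ∀ᵐ ω ∂P, 0 ≤ X T ω := by
  have h := tele (u := fun t => ∫ ω, (max (-X t ω) 0) ^ 2 ∂P) hT ?_
  · have h0 : ∫ ω, (max (-X 0 ω) 0) ^ 2 ∂P = 0 := by
      simp [S.init, hx]
    simp only [h0] at h
    have h1 : ∫ ω, (max (-X T ω) 0) ^ 2 ∂P = 0 :=
      le_antisymm h (integral_nonneg fun ω => sq_nonneg _)
    rw [integral_eq_zero_iff_of_nonneg (fun ω => sq_nonneg _) (S.memNeg T).integrable_sq] at h1
    filter_upwards [h1] with ω hω
    simp at hω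
    exact hω
  intro η hη
  set ε := η / 12 with hε
  have hε0 : 0 < ε := by positivity
  obtain ⟨h1, hh1, H1⟩ := S.lind T hε0 (η := η / 3) (by positivity)
  obtain ⟨h2, hh2, H2⟩ := S.V2 T (η := η / 3) (by positivity)
  refine ⟨min h1 h2, by positivity, fun a b ha hab hb hh => ?_⟩
  replace H1 := H1 a b ha hab hb (hh.trans (min_le_left _ _))
  obtain ⟨I2, H2⟩ := H2 a b ha hab hb (hh.trans (min_le_right _ _))
  set D := fun ω => cM δ x X b ω - cM δ x X a ω with hD
  set DV := fun ω => cV X b ω - cV X a ω with hDV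
  set G := {ω | ε < |cM δ x X b ω - cM δ x X a ω|} with hG
  have hGm : MeasurableSet G := S.measGt a b ε
  set Z1 : Ω → ℝ := fun ω => 2 * max (-X a ω) 0 with hZ1
  have hZ1m : StronglyMeasurable[ℱ a] Z1 :=
    (((S.meas a).neg.max measurable_const).const_mul 2).stronglyMeasurable
  have J1 : Integrable (fun ω => D ω • Z1 ω) P :=
    (S.memD a b).integrable_mul ((S.memNeg a).const_mul 2)
  have E1 : ∫ ω, D ω • Z1 ω ∂P = 0 := mart_mul S.martM hab hZ1m J1
  set Z2 : Ω → ℝ := {ω | X a ω ≤ ε}.indicator fun _ => (1 : ℝ) with hZ2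
  have hZ2m : StronglyMeasurable[ℱ a] Z2 :=
    stronglyMeasurable_const.indicator (measurableSet_le (S.meas a) measurable_const)
  obtain ⟨J2, E2⟩ := S.E2 hab hZ2m (K := 1) (fun ω => by
      by_cases h : X a ω ≤ ε <;> simp [hZ2, h])
  have J3 : Integrable (G.indicator fun ω => D ω ^ 2) P := (S.intD2 a b).indicator hGm
  have J0 := (S.memNeg a).integrable_sq
  have key : ∫ ω, (max (-X b ω) 0) ^ 2 ∂P ≤ ∫ ω, ((((((max (-X a ω) 0) ^ 2
      - D ω • Z1 ω) + ((D ω) ^ 2 - DV ω) • Z2 ω) + |DV ω - 4 * (b - a) * max (X a ω) 0|)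
      + G.indicator (fun ω => D ω ^ 2) ω) + 4 * (b - a) * ε) ∂P := by
    refine integral_mono (S.memNeg b).integrable_sq
      (((((J0.sub J1).add J2).add I2).add J3).add (integrable_const _)) fun ω => ?_
    have hXb := S.dX ha hab ω
    refine neg_pw (xa := X a ω) (xb := X b ω) (d := D ω) (dv := DV ω) (h := b - a) (ε := ε)
      (z := Z2 ω) (g := G.indicator (fun ω => D ω ^ 2) ω) (c := δ * (b - a)) (by linarith)
      (mul_nonneg hδ (by linarith)) hε0.le (by linarith)
      (Set.indicator_nonneg (fun ω _ => sq_nonneg _) ω) ?_ ?_ ?_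
    · intro hc
      simp [hZ2, hc]
    · intro hc
      have : ¬ X a ω ≤ ε := not_le.2 hc
      simp [hZ2, this]
    · intro hc
      have hmem : ω ∈ G := hc
      rw [Set.indicator_of_mem hmem]
  replace key := key.trans_eq (int6 J0 J1 J2 I2 J3 (4 * (b - a) * ε))
  rw [E1, E2, integral_indicator hGm] at key
  have : 4 * (b - a) * ε = η / 3 * (b - a) := by rw [hε]; ring
  linarith

end Sol
end

theorem exp_taylor {z w : ℂ} (hz : z.re ≤ 0) (hw : w.re ≤ 0) :
    ‖Complex.exp w - Complex.exp z - Complex.exp z * ((w - z) + (w - z) ^ 2 / 2)‖ ≤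
      ‖w - z‖ ^ 3 ∧
    ‖Complex.exp w - Complex.exp z - Complex.exp z * ((w - z) + (w - z) ^ 2 / 2)‖ ≤
      2 * ‖w - z‖ ^ 2 := by
  set R := ‖w - z‖ with hR
  have hconv : Convex ℝ ({v : ℂ | v.re ≤ 0} ∩ Metric.closedBall z R) :=
    (convex_halfSpace_re_le 0).inter (convex_closedBall z R)
  have hzm : z ∈ ({v : ℂ | v.re ≤ 0} ∩ Metric.closedBall z R) :=
    ⟨hz, Metric.mem_closedBall_self (norm_nonneg _)⟩
  have hwm : w ∈ ({v : ℂ | v.re ≤ 0} ∩ Metric.closedBall z R) :=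
    ⟨hw, by rw [Metric.mem_closedBall, dist_eq_norm]⟩
  have hez : ‖Complex.exp z‖ ≤ 1 := by rw [Complex.norm_exp]; exact Real.exp_le_one_iff.2 hz
  have s1 : ∀ v ∈ ({v : ℂ | v.re ≤ 0} ∩ Metric.closedBall z R),
      ‖Complex.exp v - Complex.exp z‖ ≤ R := by
    intro v hv
    have := hconv.norm_image_sub_le_of_norm_hasDerivWithin_le (f := Complex.exp)
      (f' := Complex.exp) (C := 1)
      (fun y _ => (Complex.hasDerivAt_exp y).hasDerivWithinAt)
      (fun y hy => by rw [Complex.norm_exp]; exact Real.exp_le_one_iff.2 hy.1) hzm hv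
    have h2 : ‖v - z‖ ≤ R := by rw [← dist_eq_norm]; exact hv.2
    linarith
  have s2 : ∀ v ∈ ({v : ℂ | v.re ≤ 0} ∩ Metric.closedBall z R),
      ‖Complex.exp v - Complex.exp z - Complex.exp z * (v - z)‖ ≤ R * R := by
    intro v hv
    have := hconv.norm_image_sub_le_of_norm_hasDerivWithin_le
      (f := fun v => Complex.exp v - Complex.exp z - Complex.exp z * (v - z))
      (f' := fun v => Complex.exp v - Complex.exp z) (C := R)
      (fun y _ => by
        have := ((Complex.hasDerivAt_exp y).sub_const (Complex.exp z)).sub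
          (((hasDerivAt_id y).sub_const z).const_mul (Complex.exp z))
        refine (HasDerivAt.congr_deriv this ?_).hasDerivWithinAt
        simp)
      s1 hzm hv
    have h2 : ‖v - z‖ ≤ R := by rw [← dist_eq_norm]; exact hv.2
    simp only [sub_self, mul_zero, sub_zero] at this
    exact this.trans (mul_le_mul_of_nonneg_left h2 (norm_nonneg _))
  have s3 := hconv.norm_image_sub_le_of_norm_hasDerivWithin_le
      (f := fun v => Complex.exp v - Complex.exp z - Complex.exp z * ((v - z) + (v - z) ^ 2 / 2))
      (f' := fun v => Complex.exp v - Complex.exp z - Complex.exp z * (v - z)) (C := R * R)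
      (fun y _ => by
        have h1 := (hasDerivAt_id y).sub_const z
        have := ((Complex.hasDerivAt_exp y).sub_const (Complex.exp z)).sub
          ((h1.add ((h1.pow 2).div_const 2)).const_mul (Complex.exp z))
        refine (HasDerivAt.congr_deriv this ?_).hasDerivWithinAt
        simp
        ring)
      s2 hzm hwm
  simp only [sub_self, mul_zero, sub_zero, add_zero, ne_eq, OfNat.ofNat_ne_zero,
    not_false_eq_true, zero_pow, zero_div] at s3
  refine ⟨by rw [← hR] at s3; linarith [show R * R * R = R ^ 3 by ring], ?_⟩
  have e : Complex.exp w - Complex.exp z - Complex.exp z * ((w - z) + (w - z) ^ 2 / 2) =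
      (Complex.exp w - Complex.exp z - Complex.exp z * (w - z))
      - Complex.exp z * ((w - z) ^ 2 / 2) := by ring
  rw [e]
  have h4 : ‖Complex.exp z * ((w - z) ^ 2 / 2)‖ ≤ R ^ 2 := by
    rw [norm_mul, norm_div, norm_pow, ← hR]
    simp only [Complex.norm_ofNat]
    have : 0 ≤ R ^ 2 := by positivity
    nlinarith [norm_nonneg (Complex.exp z)]
  have := norm_sub_le (Complex.exp w - Complex.exp z - Complex.exp z * (w - z))
    (Complex.exp z * ((w - z) ^ 2 / 2))
  have := s2 w hwm
  nlinarith

theorem ricc {lam : ℂ} (hl : 0 ≤ lam.re) (T : ℝ) : ∃ ψ γ : ℝ → ℂ, ψ T = lam ∧ γ T = 0 ∧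
    (∀ r ≤ T, ‖ψ r‖ ≤ ‖lam‖ ∧ 0 ≤ (ψ r).re ∧ (γ r).re ≤ 0) ∧
    (∀ a b : ℝ, a ≤ b → b ≤ T → ψ b - ψ a = 2 * ψ a * ψ b * ((b - a : ℝ) : ℂ) ∧
      ‖γ b - γ a - ψ a * ((b - a : ℝ) : ℂ)‖ ≤ 2 * ‖lam‖ ^ 2 * (b - a) ^ 2) := by
  set den : ℝ → ℂ := fun r => 1 + 2 * lam * ((T - r : ℝ) : ℂ) with hden
  set ψ : ℝ → ℂ := fun r => lam / den r with hψ
  have hre : ∀ r ≤ T, 1 ≤ (den r).re := by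
    intro r hr
    simp [hden]
    have : 0 ≤ T - r := by linarith
    positivity
  have hn : ∀ r ≤ T, 1 ≤ ‖den r‖ := fun r hr => (hre r hr).trans (Complex.re_le_norm _)
  have hne : ∀ r ≤ T, den r ≠ 0 := fun r hr h0 => by
    have := hn r hr
    rw [h0, norm_zero] at this
    linarith
  have hb : ∀ r ≤ T, ‖ψ r‖ ≤ ‖lam‖ := by
    intro r hr
    rw [hψ]
    simp only [norm_div]
    exact div_le_self (norm_nonneg _) (hn r hr)
  have hpr : ∀ r ≤ T, 0 ≤ (ψ r).re := by
    intro r hr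
    simp only [hψ, Complex.div_re]
    have h1 := hre r hr
    have h2 : (den r).im * lam.im = 2 * lam.im ^ 2 * (T - r) := by
      simp [hden]; ring
    have h3 : 0 ≤ T - r := by linarith
    have h4 : 0 ≤ lam.im * (den r).im := by rw [mul_comm, h2]; positivity
    have h5 : 0 ≤ lam.re * (den r).re := mul_nonneg hl (by linarith)
    have := Complex.normSq_nonneg (den r)
    positivity
  have hd : ∀ a b : ℝ, a ≤ b → b ≤ T → ψ b - ψ a = 2 * ψ a * ψ b * ((b - a : ℝ) : ℂ) := by
    intro a b hab hbT
    have h1 := hne a (hab.trans hbT)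
    have h2 := hne b hbT
    have h3 : den a - den b = 2 * lam * ((b - a : ℝ) : ℂ) := by
      simp [hden]; ring
    simp only [hψ]
    rw [div_sub_div _ _ h2 h1]
    have : lam * den a - den b * lam = lam * (den a - den b) := by ring
    rw [this, h3]
    field_simp
  have hcont : ContinuousOn ψ (Set.Iic T) := by
    refine continuousOn_const.div ?_ fun r hr => hne r hr
    refine Continuous.continuousOn ?_
    simp only [hden]
    fun_prop
  have hii : ∀ a b : ℝ, a ≤ b → b ≤ T → IntervalIntegrable ψ volume a b := by
    intro a b hab hbT
    refine ContinuousOn.intervalIntegrable_of_Icc hab (hcont.mono fun r hr => hr.2.trans hbT)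
  refine ⟨ψ, fun r => -∫ y in r..T, ψ y, by simp [hψ, hden], by simp, ?_, ?_⟩
  · intro r hr
    refine ⟨hb r hr, hpr r hr, ?_⟩
    have : (∫ y in r..T, ψ y).re = ∫ y in r..T, (ψ y).re :=
      (Complex.reCLM.intervalIntegral_comp_comm (hii r T hr le_rfl)).symm
    simp only [Complex.neg_re, this]
    have : 0 ≤ ∫ y in r..T, (ψ y).re :=
      intervalIntegral.integral_nonneg hr fun y hy => hpr y hy.2
    linarith
  · intro a b hab hbT
    refine ⟨hd a b hab hbT, ?_⟩
    have e1 : (-∫ y in b..T, ψ y) - (-∫ y in a..T, ψ y) = ∫ y in a..b, ψ y := by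
      rw [← intervalIntegral.integral_add_adjacent_intervals (hii a b hab hbT) (hii b T hbT le_rfl)]
      ring
    have e2 : ψ a * ((b - a : ℝ) : ℂ) = ∫ y in a..b, ψ a := by
      simp [mul_comm]
    rw [e1, e2, ← intervalIntegral.integral_sub (hii a b hab hbT) intervalIntegrable_const]
    have h0 : 0 ≤ b - a := by linarith
    have := intervalIntegral.norm_integral_le_of_norm_le_const (a := a) (b := b)
      (f := fun y => ψ y - ψ a) (C := 2 * ‖lam‖ ^ 2 * (b - a)) (by
        intro y hy
        rw [Set.uIoc_of_le hab] at hy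
        rw [hd a y hy.1.le (hy.2.trans hbT), norm_mul, norm_mul, norm_mul, Complex.norm_real,
          Real.norm_of_nonneg (by linarith [hy.1]), Complex.norm_ofNat]
        have h1 := hb a (hab.trans hbT)
        have h2 := hb y (hy.2.trans hbT)
        have h3 : y - a ≤ b - a := by linarith [hy.2]
        have h4 : 0 ≤ y - a := by linarith [hy.1]
        calc 2 * ‖ψ a‖ * ‖ψ y‖ * (y - a) ≤ 2 * ‖lam‖ * ‖lam‖ * (b - a) := by gcongr
          _ = _ := by ring)
    rw [abs_of_nonneg h0] at this
    linarith

set_option linter.unusedSectionVars false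


theorem aux1 (h xa xb : ℝ) : h ^ 2 ≤ h ^ 2 * (1 + xa ^ 2 + xb ^ 2) :=
  le_mul_of_one_le_right (sq_nonneg h) (by linarith [sq_nonneg xa, sq_nonneg xb])

theorem aux2 (xa xb : ℝ) : xb ≤ 1 + xa ^ 2 + xb ^ 2 := by
  nlinarith [sq_nonneg (xb - 1), sq_nonneg xa]

theorem aux3 (xa xb : ℝ) : (1 + xb) ^ 2 ≤ 2 * (1 + xa ^ 2 + xb ^ 2) := by
  nlinarith [sq_nonneg (xb - 1), sq_nonneg xa]

set_option maxHeartbeats 4000000 in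
theorem cpx_pw {L G δ : ℝ} (hL : 0 ≤ L) (hG : 0 ≤ G) (hδ : 0 ≤ δ) :
    ∃ K > 0, ∀ (m dv xa xb h ε ι : ℝ) (ψa ψb γa γb : ℂ), 0 ≤ xa → 0 ≤ xb → 0 ≤ h → h ≤ 1 →
      xb - xa = m + δ * h → ‖ψa‖ ≤ L → ‖ψb‖ ≤ L → 0 ≤ ψa.re → 0 ≤ ψb.re → γa.re ≤ 0 →
      γb.re ≤ 0 → ψb - ψa = 2 * ψa * ψb * (h : ℂ) → ‖γb - γa - ψa * (h : ℂ)‖ ≤ G * h ^ 2 →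
      0 < ε → ε ≤ 1 → 0 ≤ ι → (ε < |m| → m ^ 2 ≤ ι) →
      ‖Complex.exp (-ψb * xb + δ * γb) - Complex.exp (-ψa * xa + δ * γa)
        + m • (Complex.exp (-ψa * xa + δ * γa) * ψa)
        - (m ^ 2 - dv) • (Complex.exp (-ψa * xa + δ * γa) * (ψa ^ 2 / 2))‖ ≤
        K * (ε * m ^ 2 + ι + |dv - 4 * h * xa| + h ^ 2 / ε * (1 + xa ^ 2 + xb ^ 2)) := by
  set K1 := 2 * L ^ 2 + δ * G with hK1
  have hK10 : 0 ≤ K1 := by positivity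
  refine ⟨16 * K1 ^ 2 + 8 * L ^ 3 + 8 * L ^ 2 + (K1 ^ 2 + L + L * 2 * K1 ^ 2)
    + L ^ 2 + 2 * L ^ 2 + 2 * L ^ 2 * δ + 4 * L ^ 3 + δ * G + 1, by positivity, ?_⟩
  intro m dv xa xb h ε ι ψa ψb γa γb hxa hxb hh hh1 hx hLa hLb hra hrb hga hgb hψ hγ hε hε1 hι hm
  set z : ℂ := -ψa * xa + δ * γa with hz
  set w : ℂ := -ψb * xb + δ * γb with hw
  have hzr : z.re ≤ 0 := by
    simp [hz]; linarith [mul_nonneg hra hxa, mul_nonneg hδ (neg_nonneg.2 hga)]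
  have hwr : w.re ≤ 0 := by
    simp [hw]; linarith [mul_nonneg hrb hxb, mul_nonneg hδ (neg_nonneg.2 hgb)]
  obtain ⟨T3, T2⟩ := exp_taylor hzr hwr
  have hez : ‖Complex.exp z‖ ≤ 1 := by rw [Complex.norm_exp]; exact Real.exp_le_one_iff.2 hzr
  set e := Complex.exp z with he
  set R := Complex.exp w - e - e * ((w - z) + (w - z) ^ 2 / 2) with hR
  have hxc : (xb : ℂ) = xa + m + δ * h := by
    have : xb = xa + m + δ * h := by linarith
    rw [this]; push_cast; ring
  set κ : ℂ := γb - γa - ψa * (h : ℂ) with hκ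
  set ρ : ℂ := -(2 * ψa * ψb * h) * xb + δ * κ with hρ
  have hd : w - z = -ψa * m + ρ := by
    rw [hρ, ← hψ, hκ, hw, hz, hxc]; ring
  set q := h ^ 2 / ε * (1 + xa ^ 2 + xb ^ 2) with hq
  have hqε : ε * q = h ^ 2 * (1 + xa ^ 2 + xb ^ 2) := by rw [hq]; field_simp
  have hq0 : 0 ≤ q := by positivity
  have hhq : h ^ 2 * (1 + xa ^ 2 + xb ^ 2) ≤ q := by
    rw [← hqε]; exact mul_le_of_le_one_left hq0 hε1
  have hρn : ‖ρ‖ ≤ K1 * (h * (1 + xb)) := by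
    calc ‖ρ‖ ≤ ‖-(2 * ψa * ψb * h) * (xb : ℂ)‖ + ‖δ * κ‖ := norm_add_le _ _
      _ = 2 * ‖ψa‖ * ‖ψb‖ * h * xb + δ * ‖κ‖ := by
        simp [abs_of_nonneg hh, abs_of_nonneg hxb, abs_of_nonneg hδ]
      _ ≤ 2 * L * L * h * xb + δ * (G * h ^ 2) := by gcongr
      _ ≤ K1 * (h * (1 + xb)) := by
        rw [hK1]
        have : δ * G * h ^ 2 ≤ δ * G * (h * (1 + xb)) := by
          refine mul_le_mul_of_nonneg_left ?_ (by positivity)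
          nlinarith [mul_nonneg hh hxb]
        have : 0 ≤ L ^ 2 * h := by positivity
        linarith [show (2 * L ^ 2 + δ * G) * (h * (1 + xb)) = 2 * L * L * h * xb + 2 * (L ^ 2 * h)
          + δ * G * (h * (1 + xb)) by ring]
  have hρ2 : ‖ρ‖ ^ 2 ≤ 2 * K1 ^ 2 * (ε * q) := by
    have h1 : ‖ρ‖ ^ 2 ≤ (K1 * (h * (1 + xb))) ^ 2 := pow_le_pow_left₀ (norm_nonneg _) hρn 2
    rw [hqε]
    have h2 : (1 + xb) ^ 2 ≤ 2 * (1 + xa ^ 2 + xb ^ 2) := aux3 xa xb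
    calc ‖ρ‖ ^ 2 ≤ K1 ^ 2 * h ^ 2 * (1 + xb) ^ 2 := by linarith [show (K1 * (h * (1 + xb))) ^ 2 = K1 ^ 2 * h ^ 2 * (1 + xb) ^ 2 by ring]
      _ ≤ K1 ^ 2 * h ^ 2 * (2 * (1 + xa ^ 2 + xb ^ 2)) := by gcongr
      _ = _ := by ring
  have hεq : ε * q ≤ q := mul_le_of_le_one_left hq0 hε1
  have hρ2' : ‖ρ‖ ^ 2 ≤ 2 * K1 ^ 2 * q := hρ2.trans (by gcongr)
  have hdn : ‖w - z‖ ≤ L * |m| + ‖ρ‖ := by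
    rw [hd]
    refine (norm_add_le _ _).trans ?_
    simp only [norm_mul, norm_neg, Complex.norm_real, Real.norm_eq_abs]
    gcongr
  have hRn : ‖R‖ ≤ 16 * K1 ^ 2 * q + 8 * L ^ 3 * (ε * m ^ 2) + 8 * L ^ 2 * ι := by
    have p1 : 0 ≤ 8 * L ^ 3 * (ε * m ^ 2) := by positivity
    have p2 : 0 ≤ 8 * L ^ 2 * ι := by positivity
    have p3 : 0 ≤ 16 * K1 ^ 2 * q := by positivity
    rcases le_total (L * |m|) ‖ρ‖ with hc | hc
    · have : ‖w - z‖ ^ 2 ≤ (2 * ‖ρ‖) ^ 2 := pow_le_pow_left₀ (norm_nonneg _) (by linarith) 2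
      linarith [show (2 * ‖ρ‖) ^ 2 = 4 * ‖ρ‖ ^ 2 by ring]
    · have h2 : ‖w - z‖ ≤ 2 * (L * |m|) := by linarith
      by_cases hc2 : ε < |m|
      · have h3 : ‖w - z‖ ^ 2 ≤ (2 * (L * |m|)) ^ 2 := pow_le_pow_left₀ (norm_nonneg _) h2 2
        have h4 : (2 * (L * |m|)) ^ 2 = 4 * L ^ 2 * m ^ 2 := by
          rw [mul_pow, mul_pow, sq_abs]; ring
        have h5 : L ^ 2 * m ^ 2 ≤ L ^ 2 * ι := mul_le_mul_of_nonneg_left (hm hc2) (by positivity)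
        linarith
      · push Not at hc2
        have h3 : ‖w - z‖ ^ 3 ≤ (2 * (L * |m|)) ^ 3 := pow_le_pow_left₀ (norm_nonneg _) h2 3
        have h4 : (2 * (L * |m|)) ^ 3 = 8 * L ^ 3 * (|m| * m ^ 2) := by
          rw [← sq_abs m]; ring
        have h5 : 8 * L ^ 3 * (|m| * m ^ 2) ≤ 8 * L ^ 3 * (ε * m ^ 2) := by gcongr
        linarith
  -- second-order cross term
  have hB : ‖(w - z) ^ 2 - ψa ^ 2 * (m : ℂ) ^ 2‖ ≤
      2 * K1 ^ 2 * q + L * (ε * m ^ 2) + L * (2 * K1 ^ 2 * q) := by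
    have e1 : (w - z) ^ 2 - ψa ^ 2 * (m : ℂ) ^ 2 = ρ ^ 2 - 2 * ψa * m * ρ := by rw [hd]; ring
    rw [e1]
    have h1 : 2 * |m| * ‖ρ‖ ≤ ε * m ^ 2 + 2 * K1 ^ 2 * q := by
      have h2 : 2 * (ε * |m|) * ‖ρ‖ ≤ (ε * |m|) ^ 2 + ‖ρ‖ ^ 2 := two_mul_le_add_sq _ _
      have h3 : ε * (2 * |m| * ‖ρ‖) ≤ ε * (ε * m ^ 2 + 2 * K1 ^ 2 * q) := by
        rw [mul_pow, sq_abs] at h2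
        linarith [show ε * (ε * m ^ 2 + 2 * K1 ^ 2 * q) = ε ^ 2 * m ^ 2 + 2 * K1 ^ 2 * (ε * q) by ring,
          show ε * (2 * |m| * ‖ρ‖) = 2 * (ε * |m|) * ‖ρ‖ by ring]
      exact le_of_mul_le_mul_left h3 hε
    calc ‖ρ ^ 2 - 2 * ψa * m * ρ‖ ≤ ‖ρ ^ 2‖ + ‖2 * ψa * m * ρ‖ := norm_sub_le _ _
      _ = ‖ρ‖ ^ 2 + ‖ψa‖ * (2 * |m| * ‖ρ‖) := by simp; ring
      _ ≤ 2 * K1 ^ 2 * q + L * (ε * m ^ 2 + 2 * K1 ^ 2 * q) := by gcongr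
      _ = _ := by ring
  have hC : ‖ρ + ψa ^ 2 / 2 * dv‖ ≤ L ^ 2 * |dv - 4 * h * xa| + 2 * L ^ 2 * (ε * m ^ 2 + q)
      + 2 * L ^ 2 * δ * q + 4 * L ^ 3 * q + δ * G * q := by
    have e1 : ρ + ψa ^ 2 / 2 * dv = ψa ^ 2 / 2 * ((dv - 4 * h * xa : ℝ) : ℂ)
        - 2 * ψa ^ 2 * ((h * m : ℝ) : ℂ) - 2 * ψa ^ 2 * δ * ((h ^ 2 : ℝ) : ℂ)
        - 4 * ψa ^ 2 * ψb * ((h ^ 2 * xb : ℝ) : ℂ) + δ * κ := by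
      have hb : ψb = ψa + 2 * ψa * ψb * h := by rw [← hψ]; ring
      have e2 : 2 * ψa * ψb * h * (xb : ℂ) = 2 * ψa ^ 2 * h * xb + 4 * ψa ^ 2 * ψb * h ^ 2 * xb := by
        linear_combination 2 * ψa * h * xb * hb
      rw [hρ]
      push_cast
      linear_combination (-1 : ℂ) * e2 - 2 * ψa ^ 2 * h * hxc
    rw [e1]
    have hh2 : h ^ 2 ≤ q := by
      exact (aux1 h xa xb).trans hhq
    have hh3 : h ^ 2 * xb ≤ q := by
      refine le_trans ?_ hhq
      refine mul_le_mul_of_nonneg_left ?_ (sq_nonneg h)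
      exact aux2 xa xb
    have hhm : h * |m| ≤ ε * m ^ 2 + q := by
      have h1 : ε * (h * |m|) ≤ ε * (ε * m ^ 2 + q) := by
        have h2 : h * (ε * |m|) * 2 ≤ h ^ 2 + (ε * |m|) ^ 2 := by
          linarith [two_mul_le_add_sq h (ε * |m|)]
        have h3 : h ^ 2 ≤ ε * q := by
          rw [hqε]; exact aux1 h xa xb
        rw [mul_pow, sq_abs] at h2
        have : 0 ≤ h * (ε * |m|) := by positivity
        linarith [show ε * (ε * m ^ 2 + q) = ε ^ 2 * m ^ 2 + ε * q by ring,
          show ε * (h * |m|) = h * (ε * |m|) by ring]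
      exact le_of_mul_le_mul_left h1 hε
    have hκq : ‖κ‖ ≤ G * q := hγ.trans (by gcongr)
    have n1 : ‖ψa ^ 2 / 2 * ((dv - 4 * h * xa : ℝ) : ℂ)‖ ≤ L ^ 2 * |dv - 4 * h * xa| := by
      rw [norm_mul, norm_div, norm_pow, Complex.norm_real, Real.norm_eq_abs, Complex.norm_ofNat]
      gcongr
      have : ‖ψa‖ ^ 2 ≤ L ^ 2 := by gcongr
      linarith [sq_nonneg ‖ψa‖]
    have n2 : ‖2 * ψa ^ 2 * ((h * m : ℝ) : ℂ)‖ ≤ 2 * L ^ 2 * (ε * m ^ 2 + q) := by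
      rw [norm_mul, norm_mul, norm_pow, Complex.norm_real, Real.norm_eq_abs, Complex.norm_ofNat,
        abs_mul, abs_of_nonneg hh]
      gcongr
    have n3 : ‖2 * ψa ^ 2 * δ * ((h ^ 2 : ℝ) : ℂ)‖ ≤ 2 * L ^ 2 * δ * q := by
      rw [norm_mul, norm_mul, norm_mul, norm_pow, Complex.norm_real, Complex.norm_real,
        Real.norm_of_nonneg hδ, Real.norm_of_nonneg (sq_nonneg h), Complex.norm_ofNat]
      gcongr
    have n4 : ‖4 * ψa ^ 2 * ψb * ((h ^ 2 * xb : ℝ) : ℂ)‖ ≤ 4 * L ^ 3 * q := by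
      rw [norm_mul, norm_mul, norm_mul, norm_pow, Complex.norm_real,
        Real.norm_of_nonneg (by positivity), Complex.norm_ofNat]
      calc 4 * ‖ψa‖ ^ 2 * ‖ψb‖ * (h ^ 2 * xb) ≤ 4 * L ^ 2 * L * q := by gcongr
        _ = _ := by ring
    have n5 : ‖(δ : ℂ) * κ‖ ≤ δ * G * q := by
      rw [norm_mul, Complex.norm_real, Real.norm_of_nonneg hδ, mul_assoc]
      gcongr
    refine (norm_add_le _ _).trans ?_
    refine add_le_add ((norm_sub_le _ _).trans (add_le_add ((norm_sub_le _ _).trans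
      (add_le_add ((norm_sub_le _ _).trans (add_le_add n1 n2)) n3)) n4)) n5
  have eq : Complex.exp w - e + m • (e * ψa) - (m ^ 2 - dv) • (e * (ψa ^ 2 / 2)) =
      R + e * ((1 / 2 : ℂ) * ((w - z) ^ 2 - ψa ^ 2 * (m : ℂ) ^ 2) + (ρ + ψa ^ 2 / 2 * dv)) := by
    simp only [Complex.real_smul, hR]
    push_cast
    linear_combination e * hd
  rw [eq]
  have hfin : ‖e * ((1 / 2 : ℂ) * ((w - z) ^ 2 - ψa ^ 2 * (m : ℂ) ^ 2) + (ρ + ψa ^ 2 / 2 * dv))‖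
      ≤ (2 * K1 ^ 2 * q + L * (ε * m ^ 2) + L * (2 * K1 ^ 2 * q)) / 2 + ‖ρ + ψa ^ 2 / 2 * dv‖ := by
    rw [norm_mul]
    refine (mul_le_of_le_one_left (norm_nonneg _) hez).trans ((norm_add_le _ _).trans ?_)
    gcongr
    rw [norm_mul]
    have : ‖(1 / 2 : ℂ)‖ = 1 / 2 := by simp
    rw [this]
    linarith
  have htot := (norm_add_le R (e * ((1 / 2 : ℂ) * ((w - z) ^ 2 - ψa ^ 2 * (m : ℂ) ^ 2)
    + (ρ + ψa ^ 2 / 2 * dv)))).trans (add_le_add hRn (hfin.trans (add_le_add_right hC _)))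
  refine htot.trans ?_
  have hp : 0 ≤ ε * m ^ 2 := by positivity
  have hA := abs_nonneg (dv - 4 * h * xa)
  clear_value K1 q
  generalize ε * m ^ 2 = p at *
  generalize |dv - 4 * h * xa| = A at *
  have hL2 : 0 ≤ L ^ 2 := by positivity
  have hL3 : 0 ≤ L ^ 3 := by positivity
  have hk2 : 0 ≤ K1 ^ 2 := by positivity
  have hLk2 : 0 ≤ L * K1 ^ 2 := by positivity
  have hLd : 0 ≤ L ^ 2 * δ := by positivity
  have hdG : 0 ≤ δ * G := by positivity
  have w1 := mul_nonneg hL2 hp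
  have w2 := mul_nonneg hL2 hι
  have w3 := mul_nonneg hL2 hA
  have w4 := mul_nonneg hL2 hq0
  have w5 := mul_nonneg hL3 hp
  have w6 := mul_nonneg hL3 hι
  have w7 := mul_nonneg hL3 hA
  have w8 := mul_nonneg hL3 hq0
  have w9 := mul_nonneg hk2 hp
  have w10 := mul_nonneg hk2 hι
  have w11 := mul_nonneg hk2 hA
  have w12 := mul_nonneg hk2 hq0
  have w13 := mul_nonneg hLk2 hp
  have w14 := mul_nonneg hLk2 hι
  have w15 := mul_nonneg hLk2 hA
  have w16 := mul_nonneg hLk2 hq0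
  have w17 := mul_nonneg hLd hp
  have w18 := mul_nonneg hLd hι
  have w19 := mul_nonneg hLd hA
  have w20 := mul_nonneg hLd hq0
  have w21 := mul_nonneg hdG hp
  have w22 := mul_nonneg hdG hι
  have w23 := mul_nonneg hdG hA
  have w24 := mul_nonneg hdG hq0
  have w25 := mul_nonneg hL hp
  have w26 := mul_nonneg hL hι
  have w27 := mul_nonneg hL hA
  have w28 := mul_nonneg hL hq0
  linarith

set_option linter.unusedSectionVars false

/-- The exponential functional used as test function. -/
def cF (δ : ℝ) (ψ γ : ℝ → ℂ) {Ω : Type*} (X : ℝ → Ω → ℝ) (t : ℝ) (ω : Ω) : ℂ :=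
  Complex.exp (-ψ t * ((max (X t ω) 0 : ℝ) : ℂ) + δ * γ t)

theorem int4 {Ω : Type*} [MeasurableSpace Ω] {P : Measure Ω} [IsProbabilityMeasure P]
    {f0 f1 f2 f3 f4 : Ω → ℝ} (h0 : Integrable f0 P) (h1 : Integrable f1 P) (h2 : Integrable f2 P)
    (h3 : Integrable f3 P) (h4 : Integrable f4 P) (K ε c : ℝ) :
    Integrable (fun ω => K * (ε * f0 ω + f1 ω + f2 ω + c * (1 + f3 ω + f4 ω))) P ∧
    ∫ ω, K * (ε * f0 ω + f1 ω + f2 ω + c * (1 + f3 ω + f4 ω)) ∂P =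
      K * (ε * ∫ ω, f0 ω ∂P + ∫ ω, f1 ω ∂P + ∫ ω, f2 ω ∂P +
        c * (1 + ∫ ω, f3 ω ∂P + ∫ ω, f4 ω ∂P)) := by
  have i1 := (h0.const_mul ε).add h1
  have i2 := i1.add h2
  have j1 := (integrable_const (μ := P) (1 : ℝ)).add h3
  have j2 := j1.add h4
  have i3 := i2.add (j2.const_mul c)
  refine ⟨i3.const_mul K, ?_⟩
  have e1 := integral_add (h0.const_mul ε) h1
  have e2 := integral_add i1 h2
  have e3 := integral_add i2 (j2.const_mul c)
  have e4 := integral_add (integrable_const (μ := P) (1 : ℝ)) h3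
  have e5 := integral_add j1 h4
  simp only [Pi.add_apply, integral_const_mul, integral_const, probReal_univ, one_smul]
    at e1 e2 e3 e4 e5
  rw [integral_const_mul, e3, e2, e1, e5, e4]

section
variable {Ω : Type*} [m : MeasurableSpace Ω] {P : Measure Ω} [IsProbabilityMeasure P]
    {ℱ : Filtration ℝ m}
namespace Sol
variable {δ x : ℝ} {X : ℝ → Ω → ℝ}

theorem cF_norm (hδ : 0 ≤ δ) {ψ γ : ℝ → ℂ} {t : ℝ} (h1 : 0 ≤ (ψ t).re) (h2 : (γ t).re ≤ 0)
    (ω : Ω) : ‖cF δ ψ γ X t ω‖ ≤ 1 := by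
  rw [cF, Complex.norm_exp]
  refine Real.exp_le_one_iff.2 ?_
  simp
  linarith [mul_nonneg h1 (le_max_right (X t ω) 0), mul_nonneg hδ (neg_nonneg.2 h2)]

theorem cF_meas (S : Sol P ℱ δ x X) (ψ γ : ℝ → ℂ) (t : ℝ) :
    StronglyMeasurable[ℱ t] (cF δ ψ γ X t) := by
  have h1 : StronglyMeasurable[ℱ t] fun ω => max (X t ω) 0 :=
    ((S.meas t).max measurable_const).stronglyMeasurable
  have hc : Continuous fun y : ℝ => Complex.exp (-ψ t * (y : ℂ) + δ * γ t) := by fun_prop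
  exact hc.comp_stronglyMeasurable h1

set_option maxHeartbeats 1000000 in
theorem cond (S : Sol P ℱ δ x X) (hδ : 0 ≤ δ) (hx : 0 ≤ x) {s T : ℝ} (hs : 0 ≤ s) (hsT : s ≤ T)
    {L G : ℝ} (hL : 0 ≤ L) (hG : 0 ≤ G) {ψ γ : ℝ → ℂ}
    (hr : ∀ r ≤ T, ‖ψ r‖ ≤ L ∧ 0 ≤ (ψ r).re ∧ (γ r).re ≤ 0)
    (hd : ∀ a b : ℝ, a ≤ b → b ≤ T → ψ b - ψ a = 2 * ψ a * ψ b * ((b - a : ℝ) : ℂ) ∧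
      ‖γ b - γ a - ψ a * ((b - a : ℝ) : ℂ)‖ ≤ G * (b - a) ^ 2)
    {Y : Ω → ℂ} (hY : StronglyMeasurable[ℱ s] Y) (hY1 : ∀ ω, ‖Y ω‖ ≤ 1) :
    ∫ ω, cF δ ψ γ X T ω * Y ω ∂P = ∫ ω, cF δ ψ γ X s ω * Y ω ∂P := by
  have hT : 0 ≤ T := hs.trans hsT
  have key := tele (u := fun t => ‖∫ ω, cF δ ψ γ X t ω * Y ω ∂P - ∫ ω, cF δ ψ γ X s ω * Y ω ∂P‖)
    hsT ?_
  · simp only [sub_self, norm_zero] at key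
    exact sub_eq_zero.1 (norm_le_zero_iff.1 key)
  intro η hη
  obtain ⟨K, hK, hpw⟩ := cpx_pw hL hG hδ
  obtain ⟨C, hC, hC1, hC2⟩ := S.bdds T
  set ε := min 1 (η / (4 * K * C)) with hεd
  have hε : 0 < ε := by positivity
  have hε1 : ε ≤ 1 := min_le_left _ _
  have hεK : K * (ε * C) ≤ η / 4 := by
    have : ε ≤ η / (4 * K * C) := min_le_right _ _
    calc K * (ε * C) ≤ K * (η / (4 * K * C) * C) := by gcongr
      _ = η / 4 := by field_simp
  obtain ⟨h1, hh1, H1⟩ := S.lind T hε (η := η / (4 * K)) (by positivity)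
  obtain ⟨h2, hh2, H2⟩ := S.V2 T (η := η / (4 * K)) (by positivity)
  refine ⟨min (min h1 h2) (min 1 (η * ε / (4 * K * (1 + C + C)))), by positivity,
    fun a b ha hab hb hh => ?_⟩
  have ha0 : 0 ≤ a := hs.trans ha
  have hb0 : 0 ≤ b := ha0.trans hab
  replace H1 := H1 a b ha0 hab hb (hh.trans ((min_le_left _ _).trans (min_le_left _ _)))
  obtain ⟨I2, H2⟩ := H2 a b ha0 hab hb (hh.trans ((min_le_left _ _).trans (min_le_right _ _)))
  have hh1' : b - a ≤ 1 := hh.trans ((min_le_right _ _).trans (min_le_left _ _))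
  have hhs : b - a ≤ η * ε / (4 * K * (1 + C + C)) :=
    hh.trans ((min_le_right _ _).trans (min_le_right _ _))
  have hh0 : 0 ≤ b - a := by linarith
  obtain ⟨ra1, ra2, ra3⟩ := hr a (hab.trans hb)
  obtain ⟨rb1, rb2, rb3⟩ := hr b hb
  obtain ⟨hd1, hd2⟩ := hd a b hab hb
  have hYa : StronglyMeasurable[ℱ a] Y := hY.mono (ℱ.mono ha)
  have hYm : StronglyMeasurable Y := hY.mono (ℱ.le s)
  have hFa := S.cF_meas ψ γ a
  have hFb := S.cF_meas ψ γ b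
  have nFa : ∀ ω, ‖cF δ ψ γ X a ω‖ ≤ 1 := cF_norm hδ ra2 ra3
  have nFb : ∀ ω, ‖cF δ ψ γ X b ω‖ ≤ 1 := cF_norm hδ rb2 rb3
  have Ia : Integrable (fun ω => cF δ ψ γ X a ω * Y ω) P := by
    refine Integrable.of_bound ((hFa.mono (ℱ.le a)).mul hYm).aestronglyMeasurable 1
      (Eventually.of_forall fun ω => ?_)
    rw [norm_mul]
    exact mul_le_one₀ (nFa ω) (norm_nonneg _) (hY1 ω)
  have Ib : Integrable (fun ω => cF δ ψ γ X b ω * Y ω) P := by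
    refine Integrable.of_bound ((hFb.mono (ℱ.le b)).mul hYm).aestronglyMeasurable 1
      (Eventually.of_forall fun ω => ?_)
    rw [norm_mul]
    exact mul_le_one₀ (nFb ω) (norm_nonneg _) (hY1 ω)
  obtain ⟨J1, E1⟩ := S.E1 hab (Z := fun ω => cF δ ψ γ X a ω * Y ω * ψ a) (K := L)
    ((hFa.mul hYa).mul stronglyMeasurable_const) (fun ω => by
      rw [norm_mul, norm_mul]
      calc _ ≤ 1 * 1 * L := by gcongr <;> [exact nFa ω; exact hY1 ω]
        _ = L := by ring)
  obtain ⟨J2, E2⟩ := S.E2 hab (Z := fun ω => cF δ ψ γ X a ω * Y ω * (ψ a ^ 2 / 2)) (K := L ^ 2)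
    ((hFa.mul hYa).mul stronglyMeasurable_const) (fun ω => by
      rw [norm_mul, norm_mul, norm_div, norm_pow, Complex.norm_ofNat]
      calc _ ≤ 1 * 1 * (L ^ 2 / 2) := by gcongr <;> [exact nFa ω; exact hY1 ω]
        _ ≤ L ^ 2 := by nlinarith [sq_nonneg L])
  set g : Ω → ℝ := {ω | ε < |cM δ x X b ω - cM δ x X a ω|}.indicator
    fun ω => (cM δ x X b ω - cM δ x X a ω) ^ 2 with hg
  have Jg : Integrable g P := (S.intD2 a b).indicator (S.measGt a b ε)
  have Hg : ∫ ω, g ω ∂P ≤ η / (4 * K) * (b - a) := by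
    rw [hg, integral_indicator (S.measGt a b ε)]; exact H1
  obtain ⟨Ibd, Ebd⟩ := int4 (S.intD2 a b) Jg I2 (S.intX2 a) (S.intX2 b) K ε ((b - a) ^ 2 / ε)
  have heq : ∫ ω, cF δ ψ γ X b ω * Y ω ∂P - ∫ ω, cF δ ψ γ X a ω * Y ω ∂P =
      ∫ ω, (cF δ ψ γ X b ω * Y ω - cF δ ψ γ X a ω * Y ω
        + (cM δ x X b ω - cM δ x X a ω) • (cF δ ψ γ X a ω * Y ω * ψ a)
        - ((cM δ x X b ω - cM δ x X a ω) ^ 2 - (cV X b ω - cV X a ω)) •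
          (cF δ ψ γ X a ω * Y ω * (ψ a ^ 2 / 2))) ∂P := by
    have e1 := integral_sub Ib Ia
    have e2 := integral_add (Ib.sub Ia) J1
    have e3 := integral_sub ((Ib.sub Ia).add J1) J2
    simp only [Pi.add_apply, Pi.sub_apply] at e1 e2 e3
    rw [e3, e2, e1, E1, E2]
    ring
  have hbd : ‖∫ ω, cF δ ψ γ X b ω * Y ω ∂P - ∫ ω, cF δ ψ γ X a ω * Y ω ∂P‖ ≤ η * (b - a) := by
    rw [heq]
    have hle := norm_integral_le_of_norm_le Ibd (f := fun ω =>
        (cF δ ψ γ X b ω * Y ω - cF δ ψ γ X a ω * Y ω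
        + (cM δ x X b ω - cM δ x X a ω) • (cF δ ψ γ X a ω * Y ω * ψ a)
        - ((cM δ x X b ω - cM δ x X a ω) ^ 2 - (cV X b ω - cV X a ω)) •
          (cF δ ψ γ X a ω * Y ω * (ψ a ^ 2 / 2)))) (by
      filter_upwards [S.nonneg hδ hx ha0, S.nonneg hδ hx hb0] with ω hxa hxb
      have hp := hpw (cM δ x X b ω - cM δ x X a ω) (cV X b ω - cV X a ω) (X a ω) (X b ω) (b - a) ε
        (g ω) (ψ a) (ψ b) (γ a) (γ b) hxa hxb hh0 hh1' (S.dX ha0 hab ω) ra1 rb1 ra2 rb2 ra3 rb3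
        hd1 hd2 hε hε1 (Set.indicator_nonneg (fun ω _ => sq_nonneg _) ω) (fun hc => by
          have hmem : ω ∈ {ω | ε < |cM δ x X b ω - cM δ x X a ω|} := hc
          rw [hg, Set.indicator_of_mem hmem])
      simp only [cF, max_eq_left hxa, max_eq_left hxb]
      refine le_trans ?_ hp
      refine le_trans (le_of_eq ?_) (mul_le_of_le_one_right (norm_nonneg _) (hY1 ω))
      rw [← norm_mul]
      congr 1
      simp only [Complex.real_smul]
      ring)
    refine hle.trans ?_
    rw [Ebd]
    have hA := hC1 a b ha0 hab hb
    have hX1 := hC2 a ha0 (hab.trans hb)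
    have hX2 := hC2 b hb0 hb
    have h0 : 0 ≤ (b - a) ^ 2 / ε := by positivity
    calc _ ≤ K * (ε * (C * (b - a)) + η / (4 * K) * (b - a) + η / (4 * K) * (b - a)
          + (b - a) ^ 2 / ε * (1 + C + C)) := by gcongr
      _ = K * (ε * C) * (b - a) + η / 2 * (b - a)
          + (b - a) * (K * (1 + C + C) / ε) * (b - a) := by field_simp; ring
      _ ≤ η / 4 * (b - a) + η / 2 * (b - a)
          + (η * ε / (4 * K * (1 + C + C))) * (K * (1 + C + C) / ε) * (b - a) := by gcongr
      _ = η * (b - a) := by field_simp; ring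
  have h3 := norm_sub_norm_le (∫ ω, cF δ ψ γ X b ω * Y ω ∂P - ∫ ω, cF δ ψ γ X s ω * Y ω ∂P)
    (∫ ω, cF δ ψ γ X a ω * Y ω ∂P - ∫ ω, cF δ ψ γ X s ω * Y ω ∂P)
  rw [sub_sub_sub_cancel_right] at h3
  exact h3.trans hbd

/-- The affine transform formula for times `0 ≤ s ≤ T`; `A`, `B` do not depend on the process. -/
theorem cond' {lam : ℂ} (hl : 0 ≤ lam.re) (s T : ℝ) : ∃ A B : ℂ, 0 ≤ B.re ∧
    ∀ {Ω : Type} [m : MeasurableSpace Ω] {P : Measure Ω} [IsProbabilityMeasure P]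
      {ℱ : Filtration ℝ m} {δ x : ℝ} {X : ℝ → Ω → ℝ}, Sol P ℱ δ x X → 0 ≤ δ → 0 ≤ x → 0 ≤ s →
      s ≤ T → ∀ Y : Ω → ℂ, StronglyMeasurable[ℱ s] Y → (∀ ω, ‖Y ω‖ ≤ 1) →
      ∫ ω, Complex.exp (-lam * X T ω) * Y ω ∂P =
        Complex.exp (δ * A) * ∫ ω, Complex.exp (-B * X s ω) * Y ω ∂P := by
  by_cases hsT : s ≤ T
  swap
  · exact ⟨0, 0, le_rfl, fun _ _ _ _ h => absurd h hsT⟩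
  obtain ⟨ψ, γ, h1, h2, h3, h4⟩ := ricc hl T
  refine ⟨γ s, ψ s, (h3 s hsT).2.1, ?_⟩
  intro Ω m P _ ℱ δ x X S hδ hx hs _ Y hY hY1
  have := S.cond hδ hx hs hsT (norm_nonneg lam) (by positivity) h3 h4 hY hY1
  rw [← integral_const_mul]
  refine Eq.trans ?_ (this.trans ?_)
  · refine integral_congr_ae ?_
    filter_upwards [S.nonneg hδ hx (hs.trans hsT)] with ω h0
    simp [cF, max_eq_left h0, h1, h2]
  · refine integral_congr_ae ?_
    filter_upwards [S.nonneg hδ hx hs] with ω h0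
    simp only [cF, max_eq_left h0]
    rw [add_comm, Complex.exp_add, mul_assoc]

end Sol
end

set_option linter.unusedSectionVars false

namespace Sol

theorem ae_max {Ω : Type*} [m : MeasurableSpace Ω] {P : Measure Ω} [IsProbabilityMeasure P]
    {ℱ : Filtration ℝ m} {δ x : ℝ} {X : ℝ → Ω → ℝ} (S : Sol P ℱ δ x X) (t : ℝ) :
    ∀ᵐ ω ∂P, X t ω = X (max t 0) ω := by
  rcases le_total 0 t with h | h
  · simp [max_eq_left h]
  · filter_upwards [S.neg_time h] with ω hω
    rw [hω, max_eq_right h, S.init]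

theorem nonneg' {Ω : Type*} [m : MeasurableSpace Ω] {P : Measure Ω} [IsProbabilityMeasure P]
    {ℱ : Filtration ℝ m} {δ x : ℝ} {X : ℝ → Ω → ℝ} (S : Sol P ℱ δ x X) (hδ : 0 ≤ δ) (hx : 0 ≤ x)
    (t : ℝ) : ∀ᵐ ω ∂P, 0 ≤ X t ω := by
  filter_upwards [S.ae_max t, S.nonneg hδ hx (le_max_right t 0)] with ω h1 h2
  rw [h1]; exact h2

theorem gcond {lam : ℂ} (hl : 0 ≤ lam.re) {s T : ℝ} (hsT : s ≤ T) : ∃ A B : ℂ, 0 ≤ B.re ∧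
    ∀ {Ω : Type} [m : MeasurableSpace Ω] {P : Measure Ω} [IsProbabilityMeasure P]
      {ℱ : Filtration ℝ m} {δ x : ℝ} {X : ℝ → Ω → ℝ}, Sol P ℱ δ x X → 0 ≤ δ → 0 ≤ x →
      ∀ Y : Ω → ℂ, StronglyMeasurable[ℱ s] Y → (∀ ω, ‖Y ω‖ ≤ 1) →
      ∫ ω, Complex.exp (-lam * X T ω) * Y ω ∂P =
        Complex.exp (δ * A) * ∫ ω, Complex.exp (-B * X s ω) * Y ω ∂P := by
  obtain ⟨A, B, hB, H⟩ := cond' hl (max s 0) (max T 0)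
  refine ⟨A, B, hB, ?_⟩
  intro Ω m P _ ℱ δ x X S hδ hx Y hY hY1
  have := H S hδ hx (le_max_right _ _) (max_le_max_right 0 hsT) Y
    (hY.mono (ℱ.mono (le_max_left _ _))) hY1
  refine Eq.trans ?_ (this.trans ?_)
  · refine integral_congr_ae ?_
    filter_upwards [S.ae_max T] with ω h0
    simp only [h0]
  · congr 1
    refine integral_congr_ae ?_
    filter_upwards [S.ae_max s] with ω h0
    simp only [h0]

theorem joint (I : Finset ℝ) : ∀ lam : ℝ → ℂ, (∀ t, 0 ≤ (lam t).re) → ∃ A B : ℂ,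
    ∀ {Ω : Type} [m : MeasurableSpace Ω] {P : Measure Ω} [IsProbabilityMeasure P]
      {ℱ : Filtration ℝ m} {δ x : ℝ} {X : ℝ → Ω → ℝ}, Sol P ℱ δ x X → 0 ≤ δ → 0 ≤ x →
      ∫ ω, Complex.exp (-∑ t ∈ I, lam t * X t ω) ∂P = Complex.exp (δ * A + x * B) := by
  induction I using Finset.induction_on_max with
  | empty =>
    intro lam _
    refine ⟨0, 0, ?_⟩
    intro Ω m P _ ℱ δ x X S hδ hx
    simp
  | insert a I hI ih =>
    intro lam hlam
    have hna : a ∉ I := fun h => lt_irrefl _ (hI a h)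
    rcases I.eq_empty_or_nonempty with he | hne
    · obtain ⟨A, B, hB, H⟩ := gcond (hlam a) (min_le_left a 0)
      refine ⟨A, -B, ?_⟩
      intro Ω m P _ ℱ δ x X S hδ hx
      have h1 := H S hδ hx (fun _ => 1) stronglyMeasurable_const (fun _ => by simp)
      have h2 : ∫ ω, Complex.exp (-B * X (min a 0) ω) * 1 ∂P = Complex.exp (-B * x) := by
        have : ∫ ω, Complex.exp (-B * X (min a 0) ω) * 1 ∂P = ∫ ω, Complex.exp (-B * x) ∂P := by
          refine integral_congr_ae ?_
          filter_upwards [S.neg_time (min_le_right a 0)] with ω h0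
          simp [h0]
        rw [this]; simp
      rw [h2] at h1
      subst he
      simp only [insert_empty_eq, Finset.sum_singleton]
      simp only [mul_one, neg_mul] at h1
      rw [h1, Complex.exp_add]
      congr 2
      ring
    · set s := I.max' hne with hs
      have hsI : s ∈ I := I.max'_mem hne
      obtain ⟨A, B, hB, H⟩ := gcond (hlam a) (hI s hsI).le
      obtain ⟨A', B', H'⟩ := ih (Function.update lam s (lam s + B)) (by
        intro t
        by_cases h : t = s
        · subst h; simp; linarith [hlam s]
        · simp [Function.update_of_ne h, hlam t])
      refine ⟨A + A', B', ?_⟩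
      intro Ω m P _ ℱ δ x X S hδ hx
      have hpos : ∀ᵐ ω ∂P, ∀ t ∈ I, 0 ≤ X t ω :=
        (Finset.eventually_all I).2 fun t _ => S.nonneg' hδ hx t
      have h1 := H S hδ hx
        (fun ω => Complex.exp (-∑ t ∈ I, lam t * ((max (X t ω) 0 : ℝ) : ℂ))) (by
          refine Complex.continuous_exp.comp_stronglyMeasurable (StronglyMeasurable.neg ?_)
          refine Finset.stronglyMeasurable_fun_sum I fun t ht => ?_
          have h2 : StronglyMeasurable[ℱ s] fun ω => max (X t ω) 0 :=
            (((S.meas t).max measurable_const).stronglyMeasurable).mono (ℱ.mono (I.le_max' t ht))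
          exact (Complex.continuous_ofReal.comp_stronglyMeasurable h2).const_mul (lam t))
        (fun ω => by
          rw [Complex.norm_exp]
          refine Real.exp_le_one_iff.2 ?_
          rw [Complex.neg_re, Complex.re_sum, neg_nonpos]
          refine Finset.sum_nonneg fun t _ => ?_
          rw [Complex.re_mul_ofReal]
          exact mul_nonneg (hlam t) (le_max_right _ _))
      have h2 := H' S hδ hx
      rw [mul_add, add_assoc, Complex.exp_add, ← h2]
      refine Eq.trans ?_ (h1.trans ?_)
      · refine integral_congr_ae ?_
        filter_upwards [hpos] with ω hω
        rw [Finset.sum_insert hna, neg_add, Complex.exp_add, neg_mul]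
        congr 3
        exact Finset.sum_congr rfl fun t ht => by rw [max_eq_left (hω t ht)]
      · congr 1
        refine integral_congr_ae ?_
        filter_upwards [hpos] with ω hω
        rw [← Complex.exp_add]
        congr 1
        rw [← Finset.add_sum_erase I _ hsI, ← Finset.add_sum_erase I _ hsI,
          max_eq_left (hω s hsI), Function.update_self]
        have : ∑ t ∈ I.erase s, lam t * ((max (X t ω) 0 : ℝ) : ℂ) =
            ∑ t ∈ I.erase s, Function.update lam s (lam s + B) t * (X t ω : ℂ) :=
          Finset.sum_congr rfl fun t ht => by
            rw [max_eq_left (hω t (Finset.mem_of_mem_erase ht)),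
              Function.update_of_ne (Finset.ne_of_mem_erase ht)]
        rw [this]
        ring

end Sol

set_option linter.unusedSectionVars false

theorem meas_phi (I : Finset ℝ) (c : ℝ → ℝ) :
    Measurable fun f : RPath => Complex.exp ((∑ t ∈ I, c t * f t : ℝ) * Complex.I) := by
  have : Measurable fun f : RPath => ∑ t ∈ I, c t * f t :=
    Finset.measurable_fun_sum I fun t _ => by
      have h : Measurable fun f : RPath => f t := measurable_pi_apply t
      exact h.const_mul (c t)
  exact Complex.measurable_exp.comp ((Complex.measurable_ofReal.comp this).mul_const _)

theorem law_prob {δ x : ℝ} {μ : Measure RPath} (hμ : IsGBESQLaw (fun _ => 0) (fun _ => δ) x μ) :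
    IsProbabilityMeasure μ := by
  obtain ⟨⟨Ω, P, ℱ, W, X, prob, bm, sol, law⟩⟩ := hμ
  have S := sol_of_sde sol
  rw [law, pathLaw]
  exact Measure.isProbabilityMeasure_map (measurable_pi_lambda _ S.meas').aemeasurable

theorem law_char (I : Finset ℝ) (c : ℝ → ℝ) : ∃ A B : ℂ, ∀ (δ x : ℝ) (μ : Measure RPath),
    0 ≤ δ → 0 ≤ x → IsGBESQLaw (fun _ => 0) (fun _ => δ) x μ →
      ∫ f, Complex.exp ((∑ t ∈ I, c t * f t : ℝ) * Complex.I) ∂μ =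
        Complex.exp (δ * A + x * B) := by
  obtain ⟨A, B, H⟩ := Sol.joint I (fun t => -(c t * Complex.I)) (fun t => by simp)
  refine ⟨A, B, ?_⟩
  intro δ x μ hδ hx hμ
  obtain ⟨⟨Ω, P, ℱ, W, X, prob, bm, sol, law⟩⟩ := hμ
  have S := sol_of_sde sol
  rw [law, pathLaw, integral_map (measurable_pi_lambda _ S.meas').aemeasurable
    (meas_phi I c).aestronglyMeasurable, ← H S hδ hx]
  congr 1
  funext ω
  congr 1
  push_cast
  rw [Finset.sum_mul, ← Finset.sum_neg_distrib]
  exact Finset.sum_congr rfl fun t _ => by ring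

theorem path_ext {μ ν : Measure RPath} [IsProbabilityMeasure μ] [IsProbabilityMeasure ν]
    (H : ∀ (I : Finset ℝ) (c : ℝ → ℝ),
      ∫ f, Complex.exp ((∑ t ∈ I, c t * f t : ℝ) * Complex.I) ∂μ =
      ∫ f, Complex.exp ((∑ t ∈ I, c t * f t : ℝ) * Complex.I) ∂ν) : μ = ν := by
  have hres : ∀ I : Finset ℝ, Measurable (I.restrict (π := fun _ => ℝ)) := fun I =>
    measurable_pi_lambda _ fun _ => measurable_pi_apply _
  have inst : ∀ I : Finset ℝ, IsProbabilityMeasure (ν.map (I.restrict (π := fun _ => ℝ))) :=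
    fun I => Measure.isProbabilityMeasure_map (hres I).aemeasurable
  have inst' : ∀ I : Finset ℝ, IsProbabilityMeasure (μ.map (I.restrict (π := fun _ => ℝ))) :=
    fun I => Measure.isProbabilityMeasure_map (hres I).aemeasurable
  refine IsProjectiveLimit.unique (P := fun I => ν.map (I.restrict (π := fun _ => ℝ))) ?_
    (fun I => rfl)
  intro I
  refine Measure.ext_of_charFunDual ?_
  funext L
  classical
  set c : ℝ → ℝ := fun t => if h : t ∈ I then L (Pi.single ⟨t, h⟩ 1) else 0 with hc
  have hL : ∀ f : RPath, L (I.restrict f) = ∑ t ∈ I, c t * f t := by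
    intro f
    have h1 : I.restrict f = ∑ i : I, f i • (Pi.single i (1 : ℝ) : I → ℝ) := by
      funext j
      simp [Finset.sum_apply, Pi.single_apply]
    rw [h1, map_sum, ← Finset.sum_coe_sort I]
    refine Finset.sum_congr rfl fun i _ => ?_
    rw [map_smul, smul_eq_mul, mul_comm]
    simp [hc]
  have hm : ∀ σ : Measure (I → ℝ), AEStronglyMeasurable
      (fun v : I → ℝ => Complex.exp (L v * Complex.I)) σ := fun σ =>
    Continuous.aestronglyMeasurable (by fun_prop)
  rw [charFunDual_apply, charFunDual_apply, integral_map (hres I).aemeasurable (hm _),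
    integral_map (hres I).aemeasurable (hm _)]
  simp only [hL]
  exact H I c

/-- Additivity of squared Bessel processes: `Q^δ_x ⊕ Q^{δ'}_{x'} = Q^{δ+δ'}_{x+x'}`. -/
theorem besq_additivity (δ δ' x x' : ℝ) (hδ : 0 ≤ δ) (hδ' : 0 ≤ δ')
    (hx : 0 ≤ x) (hx' : 0 ≤ x') (μ ν ρ : Measure RPath)
    (hμ : IsGBESQLaw (fun _ => 0) (fun _ => δ) x μ)
    (hν : IsGBESQLaw (fun _ => 0) (fun _ => δ') x' ν)
    (hρ : IsGBESQLaw (fun _ => 0) (fun _ => δ + δ') (x + x') ρ) :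
    mconv μ ν = ρ := by
  have i1 := law_prob hμ
  have i2 := law_prob hν
  have i3 := law_prob hρ
  have hadd : Measurable fun p : RPath × RPath => p.1 + p.2 :=
    measurable_pi_lambda _ fun t =>
      ((measurable_pi_apply t).comp measurable_fst).add ((measurable_pi_apply t).comp measurable_snd)
  have i4 : IsProbabilityMeasure (mconv μ ν) :=
    Measure.isProbabilityMeasure_map hadd.aemeasurable
  refine path_ext fun I c => ?_
  obtain ⟨A, B, H⟩ := law_char I c
  rw [H _ _ ρ (add_nonneg hδ hδ') (add_nonneg hx hx') hρ, mconv,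
    integral_map hadd.aemeasurable (meas_phi I c).aestronglyMeasurable]
  have e : ∀ p : RPath × RPath,
      Complex.exp ((∑ t ∈ I, c t * (p.1 + p.2) t : ℝ) * Complex.I) =
      Complex.exp ((∑ t ∈ I, c t * p.1 t : ℝ) * Complex.I) *
      Complex.exp ((∑ t ∈ I, c t * p.2 t : ℝ) * Complex.I) := by
    intro p
    rw [← Complex.exp_add, ← add_mul, ← Complex.ofReal_add, ← Finset.sum_add_distrib]
    simp only [Pi.add_apply, mul_add]
  simp only [e]
  rw [integral_prod_mul (fun f : RPath => Complex.exp ((∑ t ∈ I, c t * f t : ℝ) * Complex.I))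
    (fun f : RPath => Complex.exp ((∑ t ∈ I, c t * f t : ℝ) * Complex.I)),
    H _ _ μ hδ hx hμ, H _ _ ν hδ' hx' hν, ← Complex.exp_add]
  congr 1
  push_cast
  ring
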